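/- Let t ≥ 1 be an integer and let G be a 2-connected 3t-regular finite simple graph. Let 𝒪 be a set of pairwise edge-disjoint odd cycles of G and let e be an edge of G. Then for every integer l with t ≤ l ≤ 3t and l ≡ t (mod 2), there exists an l-factor F of G such that e ∈ E(F) and E(F) ∩ E(O) ≠ ∅ for every O ∈ 𝒪. -/

import Mathlib

open SimpleGraph

namespace PaperFormalization

variable {V : Type*}

/-- The degree of a vertex in a subgraph. -/
noncomputable def sdeg {G : SimpleGraph V} (H : G.Subgraph) (v : V) : ℕ :=
  (H.neighborSet v).ncard

/-- `H` is a `t`-factor of `G`: a spanning subgraph in which every vertex has degree `t`. -/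
def IsTFactor {G : SimpleGraph V} (H : G.Subgraph) (t : ℕ) : Prop :=
  H.IsSpanning ∧ ∀ v : V, sdeg H v = t

/-- A cycle of `G`: a connected 2-regular subgraph. -/
def IsCycleSG {G : SimpleGraph V} (C : G.Subgraph) : Prop :=
  C.Connected ∧ ∀ v ∈ C.verts, sdeg C v = 2

/-- An odd cycle: a cycle with an odd number of edges. -/
def IsOddCycleSG {G : SimpleGraph V} (C : G.Subgraph) : Prop :=
  IsCycleSG C ∧ Odd C.edgeSet.ncard

/-- A family of subgraphs is pairwise edge-disjoint. -/
def PairwiseEdgeDisjoint {G : SimpleGraph V} (𝒪 : Set G.Subgraph) : Prop :=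
  𝒪.Pairwise fun O₁ O₂ => Disjoint O₁.edgeSet O₂.edgeSet

/-- A family of subgraphs is pairwise vertex-disjoint. -/
def PairwiseVertexDisjoint {G : SimpleGraph V} (𝒪 : Set G.Subgraph) : Prop :=
  𝒪.Pairwise fun O₁ O₂ => Disjoint O₁.verts O₂.verts

/-- `G` is `r`-regular. -/
def IsRegular (G : SimpleGraph V) (r : ℕ) : Prop :=
  ∀ v : V, (G.neighborSet v).ncard = r

/-- `G` is 2-connected: connected, at least 3 vertices, and no cut vertex. -/
def TwoConnected [Fintype V] (G : SimpleGraph V) : Prop :=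
  G.Connected ∧ 3 ≤ Fintype.card V ∧ ∀ v : V, (G.induce {u | u ≠ v}).Connected

/-- `G` is `r`-connected: more than `r` vertices and deleting fewer than `r`
vertices leaves it connected. -/
def KConnected [Fintype V] (r : ℕ) (G : SimpleGraph V) : Prop :=
  r < Fintype.card V ∧ ∀ S : Set V, S.ncard < r → (G.induce Sᶜ).Connected

/-- A set of edges is a matching: pairwise non-adjacent edges. -/
def IsMatchingSet (M : Set (Sym2 V)) : Prop :=
  M.Pairwise fun e f => ∀ v : V, v ∈ e → v ∉ f

namespace DartGraph

section Cubic

variable {D : Type*}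

open scoped Classical in
/-- The number of edges with exactly one end in `U`, counted by their dart starting in `U`. -/
noncomputable def cutCard (A : Finset D) (θ : D → D) (vt : D → V) (U : V → Prop) : ℕ :=
  (A.filter fun d => U (vt d) ∧ ¬ U (vt (θ d))).card

open scoped Classical in
/-- A bridgeless cubic multigraph with set of darts `A`, edge involution `θ` and dart
origins `vt`. -/
structure IsCubic (A : Finset D) (θ : D → D) (vt : D → V) : Prop where
  mem : ∀ d ∈ A, θ d ∈ A
  inv : ∀ d ∈ A, θ (θ d) = d
  ne : ∀ d ∈ A, θ d ≠ d
  three : ∀ d ∈ A, (A.filter fun x => vt x = vt d).card = 3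
  bridgeless : ∀ U : V → Prop, cutCard A θ vt U ≠ 1

open scoped Classical in
/-- A set of edges having even degree at every vertex. -/
structure IsEven (A : Finset D) (θ : D → D) (vt : D → V) (L : D → Prop) : Prop where
  symm : ∀ d ∈ A, L d → L (θ d)
  even : ∀ d ∈ A, Even (A.filter fun x => vt x = vt d ∧ L x).card

/-- A perfect matching, as a set of darts. -/
structure IsPM (A : Finset D) (θ : D → D) (vt : D → V) (M : D → Prop) : Prop where
  sub : ∀ d, M d → d ∈ A
  symm : ∀ d, M d → M (θ d)
  ex : ∀ d ∈ A, ∃ x, M x ∧ vt x = vt d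
  uniq : ∀ x y, M x → M y → vt x = vt y → x = y

/-- Some perfect matching through `e` meets every odd cycle of `L`, as witnessed by a colouring. -/
def Quellable (A : Finset D) (θ : D → D) (vt : D → V) (L : D → Prop) (e : D) : Prop :=
  ∃ (M : D → Prop) (c : V → Bool), IsPM A θ vt M ∧ M e ∧
    ∀ d ∈ A, L d → ¬ M d → c (vt d) ≠ c (vt (θ d))

/-- `x`, `y`, `z` are the three darts at one vertex. -/
structure IsFiber (A : Finset D) (vt : D → V) (x y z : D) : Prop where
  mx : x ∈ A
  my : y ∈ A
  mz : z ∈ A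
  xy : x ≠ y
  xz : x ≠ z
  yz : y ≠ z
  vy : vt y = vt x
  vz : vt z = vt x
  all : ∀ w ∈ A, vt w = vt x → w = x ∨ w = y ∨ w = z

variable {A : Finset D} {θ : D → D} {vt : D → V} {L : D → Prop}

lemma IsFiber.swap {x y z : D} (h : IsFiber A vt x y z) : IsFiber A vt x z y :=
  ⟨h.mx, h.mz, h.my, h.xz, h.xy, h.yz.symm, h.vz, h.vy, fun w hw e => by
    rcases h.all w hw e with h | h | h <;> simp [h]⟩

open scoped Classical in
lemma IsFiber.filter_eq {x y z : D} (h : IsFiber A vt x y z) :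
    (A.filter fun w => vt w = vt x) = {x, y, z} := by
  ext w
  simp only [Finset.mem_filter, Finset.mem_insert, Finset.mem_singleton]
  constructor
  · rintro ⟨hw, e⟩; exact h.all w hw e
  · rintro (rfl | rfl | rfl)
    exacts [⟨h.mx, rfl⟩, ⟨h.my, h.vy⟩, ⟨h.mz, h.vz⟩]

lemma IsCubic.fiber (G : IsCubic A θ vt) {d : D} (hd : d ∈ A) : ∃ x y, IsFiber A vt d x y := by
  classical
  have h3 := G.three d hd
  have hm : d ∈ A.filter fun x => vt x = vt d := by simp [hd]
  have h2 : ((A.filter fun x => vt x = vt d).erase d).card = 2 := by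
    rw [Finset.card_erase_of_mem hm]; convert congrArg (· - 1) h3
  obtain ⟨x, y, hxy, he⟩ := Finset.card_eq_two.1 h2
  have key : ∀ w, (w ≠ d ∧ w ∈ A ∧ vt w = vt d) ↔ (w = x ∨ w = y) := fun w => by
    have := congrArg (fun s => w ∈ s) he
    simpa using this
  obtain ⟨a1, a2, a3⟩ := (key x).2 (Or.inl rfl)
  obtain ⟨b1, b2, b3⟩ := (key y).2 (Or.inr rfl)
  refine ⟨x, y, hd, a2, b2, a1.symm, b1.symm, hxy, a3, b3, fun w hw e => ?_⟩
  by_cases h : w = d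
  · exact Or.inl h
  · exact Or.inr ((key w).1 ⟨h, hw, e⟩)

lemma IsEven.iff (E : IsEven A θ vt L) {x y z : D} (h : IsFiber A vt x y z) :
    L x ↔ (L y ↔ ¬ L z) := by
  classical
  have := E.even x h.mx
  have e : (A.filter fun w => vt w = vt x ∧ L w) = ({x, y, z} : Finset D).filter L := by
    rw [← h.filter_eq, Finset.filter_filter]
  have e' : (A.filter fun w => vt w = vt x ∧ L w).card =
      (if L x then 1 else 0) + ((if L y then 1 else 0) + (if L z then 1 else 0)) := by
    rw [e, Finset.card_filter, Finset.sum_insert (by simp [h.xy, h.xz]),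
      Finset.sum_insert (by simp [h.yz]), Finset.sum_singleton]
  have this' : Even ((if L x then 1 else 0) +
      ((if L y then 1 else 0) + (if L z then 1 else 0)) : ℕ) := by
    rw [← e']; convert this
  by_cases h1 : L x <;> by_cases h2 : L y <;> by_cases h3 : L z <;>
    simp [h1, h2, h3] at this' ⊢ <;> exact absurd this' (by decide)

lemma IsEven.mem_iff (G : IsCubic A θ vt) (E : IsEven A θ vt L) {d : D} (hd : d ∈ A) :
    L (θ d) ↔ L d :=
  ⟨fun h => by simpa [G.inv d hd] using E.symm _ (G.mem d hd) h, E.symm d hd⟩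

lemma cutCard_compl (G : IsCubic A θ vt) (U : V → Prop) :
    cutCard A θ vt (fun x => ¬ U x) = cutCard A θ vt U := by
  classical
  unfold cutCard
  refine Finset.card_bij' (fun d _ => θ d) (fun d _ => θ d) ?_ ?_ ?_ ?_ <;>
    · intro d hd
      simp only [Finset.mem_filter, not_not] at hd ⊢
      simp [G.inv d hd.1, G.mem d hd.1, hd.2.1, hd.2.2]

lemma even_card_of_involution {s : Finset D} (f : D → D) (h1 : ∀ d ∈ s, f d ∈ s)
    (h2 : ∀ d ∈ s, f (f d) = d) (h3 : ∀ d ∈ s, f d ≠ d) : Even s.card := by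
  classical
  have : (∑ _x ∈ s, (1 : ZMod 2)) = 0 :=
    Finset.sum_involution (fun d _ => f d) (fun d hd => by decide) (fun d hd _ => h3 d hd) h1 h2
  have h : ((s.card : ℕ) : ZMod 2) = 0 := by simpa using this
  exact (ZMod.natCast_eq_zero_iff_even).1 h

lemma IsCubic.no_loop (G : IsCubic A θ vt) {d : D} (hd : d ∈ A) : vt (θ d) ≠ vt d := by
  classical
  intro h
  obtain ⟨x, y, hf⟩ := G.fiber hd
  have hθ : θ d = x ∨ θ d = y := by
    rcases hf.all _ (G.mem d hd) h with h | h | h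
    · exact absurd h (G.ne d hd)
    · exact Or.inl h
    · exact Or.inr h
  obtain ⟨x, y, hf, rfl⟩ : ∃ x y, IsFiber A vt d x y ∧ θ d = x := by
    rcases hθ with h | h
    exacts [⟨x, y, hf, h⟩, ⟨y, x, hf.swap, h⟩]
  apply G.bridgeless (fun v => v = vt d)
  unfold cutCard
  rw [Finset.card_eq_one]
  refine ⟨y, ?_⟩
  ext w
  simp only [Finset.mem_filter, Finset.mem_singleton]
  constructor
  · rintro ⟨hw, e, ne⟩
    rcases hf.all w hw e with rfl | rfl | rfl
    · exact absurd h ne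
    · exact absurd (by rw [G.inv d hd]) ne
    · rfl
  · rintro rfl
    refine ⟨hf.mz, hf.vz, fun e => ?_⟩
    rcases hf.all _ (G.mem _ hf.mz) e with h | h | h
    · exact hf.yz (by rw [← h, G.inv _ hf.mz])
    · exact hf.xz (by rw [← G.inv d hd, ← h, G.inv _ hf.mz])
    · exact G.ne _ hf.mz h

end Cubic

section Contraction

variable {D : Type*} {A : Finset D} {θ : D → D} {vt : D → V} {L : D → Prop}

open scoped Classical in
/-- The darts that survive the contraction of the complement of `U`. -/
noncomputable def contractDarts (A : Finset D) (θ : D → D) (vt : D → V) (U : V → Prop) :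
    Finset D :=
  A.filter fun d => U (vt d) ∨ U (vt (θ d))

open scoped Classical in
/-- The origins of darts after contracting the complement of `U` to `w`. -/
noncomputable def contractVt (vt : D → V) (U : V → Prop) (w : V) (d : D) : V :=
  if U (vt d) then vt d else w

lemma contractVt_pos {U : V → Prop} {w : V} {d : D} (h : U (vt d)) :
    contractVt vt U w d = vt d := by simp [contractVt, h]

lemma contractVt_neg {U : V → Prop} {w : V} {d : D} (h : ¬ U (vt d)) :
    contractVt vt U w d = w := by simp [contractVt, h]

lemma mem_contractDarts {U : V → Prop} {d : D} :
    d ∈ contractDarts A θ vt U ↔ d ∈ A ∧ (U (vt d) ∨ U (vt (θ d))) := by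
  simp [contractDarts]

open scoped Classical in
lemma contract_fiber_pos {U : V → Prop} {w : V} (hw : ¬ U w) {d : D} (h : U (vt d)) :
    ((contractDarts A θ vt U).filter fun x => contractVt vt U w x = contractVt vt U w d) =
      A.filter fun x => vt x = vt d := by
  ext x
  simp only [Finset.mem_filter, mem_contractDarts, contractVt_pos h]
  by_cases hx : U (vt x)
  · simp [contractVt_pos hx, hx]
  · simp only [contractVt_neg hx]
    constructor
    · rintro ⟨-, e⟩; exact absurd (e ▸ h) hw
    · rintro ⟨-, e⟩; exact absurd (e ▸ h) hx

open scoped Classical in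
lemma contract_fiber_neg {U : V → Prop} {w : V} (hw : ¬ U w) {d : D} (h : ¬ U (vt d)) :
    ((contractDarts A θ vt U).filter fun x => contractVt vt U w x = contractVt vt U w d) =
      A.filter fun x => ¬ U (vt x) ∧ ¬ ¬ U (vt (θ x)) := by
  ext x
  simp only [Finset.mem_filter, mem_contractDarts, contractVt_neg h]
  by_cases hx : U (vt x)
  · simp only [contractVt_pos hx, hx]
    constructor
    · rintro ⟨-, e⟩; exact absurd (e ▸ hx) hw
    · rintro ⟨-, h, -⟩; exact absurd trivial h
  · simp [contractVt_neg hx, hx]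

lemma IsCubic.contract (G : IsCubic A θ vt) {U : V → Prop} {w : V} (hw : ¬ U w)
    (h3 : cutCard A θ vt U = 3) : IsCubic (contractDarts A θ vt U) θ (contractVt vt U w) := by
  classical
  refine ⟨fun d hd => ?_, fun d hd => ?_, fun d hd => ?_, fun d hd => ?_, fun W hW => ?_⟩
  · rw [mem_contractDarts] at hd ⊢
    rw [G.inv d hd.1]
    exact ⟨G.mem d hd.1, hd.2.symm⟩
  · exact G.inv d (mem_contractDarts.1 hd).1
  · exact G.ne d (mem_contractDarts.1 hd).1
  · by_cases h : U (vt d)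
    · convert G.three d (mem_contractDarts.1 hd).1 using 2
      convert contract_fiber_pos hw h
    · rw [← cutCard_compl G] at h3
      convert h3 using 1
      unfold cutCard
      congr 1
      convert contract_fiber_neg hw h
  · apply G.bridgeless (fun x => W (if U x then x else w))
    rw [← hW]
    unfold cutCard
    congr 1
    ext d
    rw [Finset.mem_filter, Finset.mem_filter, mem_contractDarts, contractVt, contractVt]
    by_cases h1 : U (vt d) <;> by_cases h2 : U (vt (θ d)) <;> simp [h1, h2]

open scoped Classical in
lemma IsEven.even_cut (G : IsCubic A θ vt) (E : IsEven A θ vt L) (U : V → Prop) :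
    Even (A.filter fun d => (U (vt d) ∧ ¬ U (vt (θ d))) ∧ L d).card := by
  have h1 : Even (A.filter fun d => U (vt d) ∧ L d).card := by
    rw [Finset.card_eq_sum_card_fiberwise (f := vt) (t := (A.filter fun d => U (vt d)).image vt)]
    · refine Finset.even_sum _ fun v hv => ?_
      obtain ⟨d, hd, rfl⟩ := Finset.mem_image.1 hv
      rw [Finset.mem_filter] at hd
      have h := E.even d hd.1
      rw [Finset.filter_filter]
      have e : (A.filter fun x => (U (vt x) ∧ L x) ∧ vt x = vt d) =
          A.filter fun x => vt x = vt d ∧ L x := by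
        ext x
        simp only [Finset.mem_filter]
        constructor
        · rintro ⟨a, ⟨-, b⟩, c⟩; exact ⟨a, c, b⟩
        · rintro ⟨a, c, b⟩; exact ⟨a, ⟨by rw [c]; exact hd.2, b⟩, c⟩
      rw [e]
      exact h
    · intro d hd
      simp only [Finset.coe_filter, Set.mem_ofPred_eq] at hd
      simp only [Finset.coe_image, Finset.coe_filter]
      exact ⟨d, ⟨hd.1, hd.2.1⟩, rfl⟩
  have h2 : Even (A.filter fun d => (U (vt d) ∧ U (vt (θ d))) ∧ L d).card := by
    refine even_card_of_involution θ ?_ ?_ ?_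
    · intro d hd
      simp only [Finset.mem_filter] at hd ⊢
      rw [G.inv d hd.1, E.mem_iff G hd.1]
      exact ⟨G.mem d hd.1, ⟨hd.2.1.2, hd.2.1.1⟩, hd.2.2⟩
    · intro d hd; exact G.inv d (Finset.mem_filter.1 hd).1
    · intro d hd; exact G.ne d (Finset.mem_filter.1 hd).1
  have h3 := Finset.card_filter_add_card_filter_not (s := A.filter fun d => U (vt d) ∧ L d)
    (fun d => U (vt (θ d)))
  rw [Finset.filter_filter, Finset.filter_filter] at h3
  have e1 : (A.filter fun d => (U (vt d) ∧ L d) ∧ U (vt (θ d))) =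
      A.filter fun d => (U (vt d) ∧ U (vt (θ d))) ∧ L d := by
    ext; simp only [Finset.mem_filter]; tauto
  have e2 : (A.filter fun d => (U (vt d) ∧ L d) ∧ ¬ U (vt (θ d))) =
      A.filter fun d => (U (vt d) ∧ ¬ U (vt (θ d))) ∧ L d := by
    ext; simp only [Finset.mem_filter]; tauto
  rw [e1, e2] at h3
  rw [← h3] at h1
  exact (Nat.even_add.1 h1).1 h2

lemma IsEven.contract (G : IsCubic A θ vt) (E : IsEven A θ vt L) {U : V → Prop} {w : V}
    (hw : ¬ U w) : IsEven (contractDarts A θ vt U) θ (contractVt vt U w) L := by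
  classical
  refine ⟨fun d hd => E.symm d (mem_contractDarts.1 hd).1, fun d hd => ?_⟩
  rw [← Finset.filter_filter]
  by_cases h : U (vt d)
  · convert E.even d (mem_contractDarts.1 hd).1 using 2
    rw [← Finset.filter_filter]
    congr 1
    convert contract_fiber_pos hw h
  · convert E.even_cut G (fun x => ¬ U x) using 2
    rw [← Finset.filter_filter]
    congr 1
    convert contract_fiber_neg hw h

lemma contractDarts_card_lt {U : V → Prop} {d : D} (hd : d ∈ A) (h1 : ¬ U (vt d))
    (h2 : ¬ U (vt (θ d))) : (contractDarts A θ vt U).card < A.card := by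
  refine Finset.card_lt_card (Finset.ssubset_iff_of_subset ?_ |>.2 ⟨d, hd, ?_⟩)
  · intro x hx; exact (mem_contractDarts.1 hx).1
  · intro h; rcases (mem_contractDarts.1 h).2 with h | h <;> contradiction

/-- Quellability passes through a nontrivial 3-edge-cut. -/
lemma Quellable.of_cut (G : IsCubic A θ vt) (E : IsEven A θ vt L) {U : V → Prop}
    (h3 : cutCard A θ vt U = 3) {e : D} (hU : U (vt e))
    (H1 : ∀ w, ¬ U w → Quellable (contractDarts A θ vt U) θ (contractVt vt U w) L e)
    (H2 : ∀ w, U w → ∀ m ∈ contractDarts A θ vt (fun x => ¬ U x),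
      Quellable (contractDarts A θ vt (fun x => ¬ U x)) θ
        (contractVt vt (fun x => ¬ U x) w) L m) :
    Quellable A θ vt L e := by
  classical
  obtain ⟨k, hk⟩ : ∃ k, k ∈ A.filter fun d => U (vt d) ∧ ¬ U (vt (θ d)) := by
    apply Finset.Nonempty.exists_mem
    rw [← Finset.card_pos]
    have : (A.filter fun d => U (vt d) ∧ ¬ U (vt (θ d))).card = 3 := by
      rw [← h3]; unfold cutCard; congr
    omega
  simp only [Finset.mem_filter] at hk
  obtain ⟨hkA, hkU, hkU'⟩ := hk
  set w := vt (θ k) with hw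
  obtain ⟨M1, c1, P1, M1e, C1⟩ := H1 w hkU'
  have hθk : θ k ∈ contractDarts A θ vt U :=
    mem_contractDarts.2 ⟨G.mem k hkA, Or.inr (by rwa [G.inv k hkA])⟩
  obtain ⟨m, hm1, hmw⟩ := P1.ex _ hθk
  rw [contractVt_neg (d := θ k) hkU'] at hmw
  have hmU : ¬ U (vt m) := fun h => by
    rw [contractVt_pos h] at hmw; exact hkU' (hmw ▸ h)
  have hmA := mem_contractDarts.1 (P1.sub m hm1)
  have hmU' : U (vt (θ m)) := hmA.2.resolve_left hmU
  have hm2 : m ∈ contractDarts A θ vt (fun x => ¬ U x) :=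
    mem_contractDarts.2 ⟨hmA.1, Or.inl hmU⟩
  set w2 := vt e with hw2
  obtain ⟨M2, c2, P2, M2m, C2⟩ := H2 w2 hU m hm2
  have hnn : ∀ {x : V}, U x → ¬ ¬ U x := fun h h' => h' h
  have key1 : ∀ d, M1 d → ¬ U (vt d) → d = m := fun d hd h =>
    P1.uniq _ _ hd hm1 (by rw [contractVt_neg h, contractVt_neg hmU])
  have key2 : ∀ d, M2 d → U (vt d) → d = θ m := fun d hd h =>
    P2.uniq _ _ hd (P2.symm _ M2m)
      (by rw [contractVt_neg (U := fun x => ¬ U x) (hnn h),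
        contractVt_neg (U := fun x => ¬ U x) (hnn hmU')])
  have hA1 : ∀ d, M1 d → d ∈ A := fun d h => (mem_contractDarts.1 (P1.sub d h)).1
  have hA2 : ∀ d, M2 d → d ∈ A := fun d h => (mem_contractDarts.1 (P2.sub d h)).1
  obtain ⟨f, hf⟩ : ∃ f : Bool, c1 w ≠ (f ^^ c2 w2) := ⟨!(c1 w ^^ c2 w2), by
    cases c1 w <;> cases c2 w2 <;> decide⟩
  have hsymm : ∀ d, (U (vt d) ∧ M1 d ∨ ¬ U (vt d) ∧ M2 d) →
      (U (vt (θ d)) ∧ M1 (θ d) ∨ ¬ U (vt (θ d)) ∧ M2 (θ d)) := by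
    rintro d (⟨hd, h⟩ | ⟨hd, h⟩)
    · by_cases h' : U (vt (θ d))
      · exact Or.inl ⟨h', P1.symm d h⟩
      · exact Or.inr ⟨h', by rw [key1 _ (P1.symm d h) h']; exact M2m⟩
    · by_cases h' : U (vt (θ d))
      · exact Or.inl ⟨h', by rw [key2 _ (P2.symm d h) h']; exact P1.symm _ hm1⟩
      · exact Or.inr ⟨h', P2.symm d h⟩
  refine ⟨fun d => U (vt d) ∧ M1 d ∨ ¬ U (vt d) ∧ M2 d,
    fun x => if U x then c1 x else (f ^^ c2 x), ⟨?_, hsymm, ?_, ?_⟩, Or.inl ⟨hU, M1e⟩, ?_⟩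
  · rintro d (⟨-, h⟩ | ⟨-, h⟩)
    exacts [hA1 d h, hA2 d h]
  · intro d hd
    by_cases h : U (vt d)
    · obtain ⟨x, hx, e⟩ := P1.ex d (mem_contractDarts.2 ⟨hd, Or.inl h⟩)
      rw [contractVt_pos h] at e
      by_cases hx' : U (vt x)
      · rw [contractVt_pos hx'] at e
        exact ⟨x, Or.inl ⟨hx', hx⟩, e⟩
      · rw [contractVt_neg hx'] at e
        exact absurd (e ▸ h) hkU'
    · obtain ⟨x, hx, e⟩ := P2.ex d (mem_contractDarts.2 ⟨hd, Or.inl h⟩)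
      rw [contractVt_pos (U := fun x => ¬ U x) h] at e
      by_cases hx' : U (vt x)
      · rw [contractVt_neg (U := fun x => ¬ U x) (hnn hx')] at e
        exact absurd (e ▸ hU) h
      · rw [contractVt_pos (U := fun x => ¬ U x) hx'] at e
        exact ⟨x, Or.inr ⟨hx', hx⟩, e⟩
  · rintro x y (⟨hx, h⟩ | ⟨hx, h⟩) (⟨hy, h'⟩ | ⟨hy, h'⟩) e
    · exact P1.uniq _ _ h h' (by rw [contractVt_pos hx, contractVt_pos hy, e])
    · exact absurd (e ▸ hx) hy
    · exact absurd (e ▸ hy) hx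
    · exact P2.uniq _ _ h h' (by
        rw [contractVt_pos (U := fun x => ¬ U x) hx, contractVt_pos (U := fun x => ¬ U x) hy, e])
  · have cross : ∀ d ∈ A, L d → U (vt d) → ¬ U (vt (θ d)) →
        ¬ (U (vt d) ∧ M1 d ∨ ¬ U (vt d) ∧ M2 d) → c1 (vt d) ≠ (f ^^ c2 (vt (θ d))) := by
      intro d hd hL h h' hM
      have n1 : ¬ M1 d := fun h1 => hM (Or.inl ⟨h, h1⟩)
      have n2 : ¬ M2 d := fun h2 => n1 (by rw [key2 d h2 h]; exact P1.symm _ hm1)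
      have a1 := C1 d (mem_contractDarts.2 ⟨hd, Or.inl h⟩) hL n1
      have a2 := C2 d (mem_contractDarts.2 ⟨hd, Or.inr h'⟩) hL n2
      rw [contractVt_pos h, contractVt_neg h'] at a1
      rw [contractVt_neg (U := fun x => ¬ U x) (hnn h),
        contractVt_pos (U := fun x => ¬ U x) h'] at a2
      revert a1 a2 hf
      cases c1 w <;> cases c2 w2 <;> cases c1 (vt d) <;> cases c2 (vt (θ d)) <;> cases f <;> decide
    intro d hd hL hM
    by_cases h : U (vt d) <;> by_cases h' : U (vt (θ d)) <;> simp only [h, h', if_true, if_false]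
    · have := C1 d (mem_contractDarts.2 ⟨hd, Or.inl h⟩) hL (fun h1 => hM (Or.inl ⟨h, h1⟩))
      rwa [contractVt_pos h, contractVt_pos h'] at this
    · exact cross d hd hL h h' hM
    · have := cross (θ d) (G.mem d hd) (E.symm d hd hL) h' (by rwa [G.inv d hd])
        (fun h => hM (by simpa [G.inv d hd] using hsymm _ h))
      rw [G.inv d hd] at this
      exact this.symm
    · have := C2 d (mem_contractDarts.2 ⟨hd, Or.inl h⟩) hL (fun h1 => hM (Or.inr ⟨h, h1⟩))
      rw [contractVt_pos (U := fun x => ¬ U x) h, contractVt_pos (U := fun x => ¬ U x) h'] at this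
      intro e
      exact this (by simpa using e)

end Contraction

section Splicing

variable {D : Type*} {A : Finset D} {θ : D → D} {vt : D → V} {L : D → Prop}

/-- Two adjacent vertices, with darts `a₀, a₁, a₂` and `p₀, p₁, p₂` and joined only by the edge
`{a₁, p₀}`, that can be spliced out by joining `θ a₀` to `θ p₁` and `θ a₂` to `θ p₂`. -/
structure Splice (A : Finset D) (θ : D → D) (vt : D → V) (a₀ a₁ a₂ p₀ p₁ p₂ : D) : Prop where
  fa : IsFiber A vt a₀ a₁ a₂
  fp : IsFiber A vt p₀ p₁ p₂
  link : θ a₁ = p₀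
  ap : vt p₀ ≠ vt a₀
  xa : vt (θ a₀) ≠ vt a₀
  xp : vt (θ a₀) ≠ vt p₀
  za : vt (θ a₂) ≠ vt a₀
  zp : vt (θ a₂) ≠ vt p₀
  ya : vt (θ p₁) ≠ vt a₀
  yp : vt (θ p₁) ≠ vt p₀
  ta : vt (θ p₂) ≠ vt a₀
  tp : vt (θ p₂) ≠ vt p₀

open scoped Classical in
/-- The darts left after splicing out the vertices `a` and `p`. -/
noncomputable def spliceDarts (A : Finset D) (vt : D → V) (a p : V) : Finset D :=
  A.filter fun d => vt d ≠ a ∧ vt d ≠ p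

open scoped Classical in
/-- The edge involution after splicing. -/
noncomputable def spliceInv (θ : D → D) (a₀ a₂ p₁ p₂ : D) (d : D) : D :=
  if d = θ a₀ then θ p₁ else if d = θ p₁ then θ a₀ else
    if d = θ a₂ then θ p₂ else if d = θ p₂ then θ a₂ else θ d

open scoped Classical in
/-- `0` if the two propositions agree, `1` otherwise. -/
noncomputable def diffCount (P Q : Prop) : ℕ := if (P ↔ Q) then 0 else 1

open scoped Classical in
/-- The vertex set that agrees with `U` off `a` and `p`, with prescribed membership there. -/
def assign (U : V → Prop) (a p : V) (α β : Prop) (x : V) : Prop :=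
  if x = a then α else if x = p then β else U x

lemma assign_left {U : V → Prop} {a p : V} {α β : Prop} : assign U a p α β a ↔ α := by
  simp [assign]

lemma assign_right {U : V → Prop} {a p : V} {α β : Prop} (h : p ≠ a) :
    assign U a p α β p ↔ β := by
  simp [assign, h]

lemma assign_off {U : V → Prop} {a p x : V} {α β : Prop} (h : x ≠ a) (h' : x ≠ p) :
    assign U a p α β x ↔ U x := by
  simp [assign, h, h']

lemma assign_self {U : V → Prop} {a p : V} : assign U a p (U a) (U p) = U := by
  funext x
  unfold assign
  split_ifs with h h'
  · rw [h]
  · rw [h']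
  · rfl

lemma mem_spliceDarts {a p : V} {d : D} :
    d ∈ spliceDarts A vt a p ↔ d ∈ A ∧ vt d ≠ a ∧ vt d ≠ p := by
  simp [spliceDarts]

namespace Splice

variable {a₀ a₁ a₂ p₀ p₁ p₂ : D}

lemma distinct (G : IsCubic A θ vt) (S : Splice A θ vt a₀ a₁ a₂ p₀ p₁ p₂) :
    θ a₀ ≠ θ a₂ ∧ θ a₀ ≠ θ p₁ ∧ θ a₀ ≠ θ p₂ ∧ θ a₂ ≠ θ p₁ ∧ θ a₂ ≠ θ p₂ ∧ θ p₁ ≠ θ p₂ := by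
  have inj : ∀ x ∈ A, ∀ y ∈ A, θ x = θ y → x = y := fun x hx y hy h => by
    rw [← G.inv x hx, h, G.inv y hy]
  have hap : ∀ x y, vt x = vt a₀ → vt y = vt p₀ → x ≠ y := fun x y hx hy h =>
    S.ap (by rw [← hy, ← h, hx])
  refine ⟨fun h => S.fa.xz (inj _ S.fa.mx _ S.fa.mz h),
    fun h => hap _ _ rfl S.fp.vy (inj _ S.fa.mx _ S.fp.my h),
    fun h => hap _ _ rfl S.fp.vz (inj _ S.fa.mx _ S.fp.mz h),
    fun h => hap _ _ S.fa.vz S.fp.vy (inj _ S.fa.mz _ S.fp.my h),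
    fun h => hap _ _ S.fa.vz S.fp.vz (inj _ S.fa.mz _ S.fp.mz h),
    fun h => S.fp.yz (inj _ S.fp.my _ S.fp.mz h)⟩

lemma inv_x : spliceInv θ a₀ a₂ p₁ p₂ (θ a₀) = θ p₁ := by simp [spliceInv]

lemma inv_y (G : IsCubic A θ vt) (S : Splice A θ vt a₀ a₁ a₂ p₀ p₁ p₂) :
    spliceInv θ a₀ a₂ p₁ p₂ (θ p₁) = θ a₀ := by
  simp [spliceInv, (S.distinct G).2.1.symm]

lemma inv_z (G : IsCubic A θ vt) (S : Splice A θ vt a₀ a₁ a₂ p₀ p₁ p₂) :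
    spliceInv θ a₀ a₂ p₁ p₂ (θ a₂) = θ p₂ := by
  obtain ⟨h1, h2, h3, h4, h5, h6⟩ := S.distinct G
  simp [spliceInv, h1.symm, h4]

lemma inv_t (G : IsCubic A θ vt) (S : Splice A θ vt a₀ a₁ a₂ p₀ p₁ p₂) :
    spliceInv θ a₀ a₂ p₁ p₂ (θ p₂) = θ a₂ := by
  obtain ⟨h1, h2, h3, h4, h5, h6⟩ := S.distinct G
  simp [spliceInv, h3.symm, h5.symm, h6.symm]

lemma inv_off {d : D} (h1 : d ≠ θ a₀) (h2 : d ≠ θ p₁) (h3 : d ≠ θ a₂) (h4 : d ≠ θ p₂) :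
    spliceInv θ a₀ a₂ p₁ p₂ d = θ d := by
  simp [spliceInv, h1, h2, h3, h4]

lemma mem_x (G : IsCubic A θ vt) (S : Splice A θ vt a₀ a₁ a₂ p₀ p₁ p₂) :
    θ a₀ ∈ spliceDarts A vt (vt a₀) (vt p₀) :=
  mem_spliceDarts.2 ⟨G.mem _ S.fa.mx, S.xa, S.xp⟩

lemma mem_y (G : IsCubic A θ vt) (S : Splice A θ vt a₀ a₁ a₂ p₀ p₁ p₂) :
    θ p₁ ∈ spliceDarts A vt (vt a₀) (vt p₀) :=
  mem_spliceDarts.2 ⟨G.mem _ S.fp.my, S.ya, S.yp⟩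

lemma mem_z (G : IsCubic A θ vt) (S : Splice A θ vt a₀ a₁ a₂ p₀ p₁ p₂) :
    θ a₂ ∈ spliceDarts A vt (vt a₀) (vt p₀) :=
  mem_spliceDarts.2 ⟨G.mem _ S.fa.mz, S.za, S.zp⟩

lemma mem_t (G : IsCubic A θ vt) (S : Splice A θ vt a₀ a₁ a₂ p₀ p₁ p₂) :
    θ p₂ ∈ spliceDarts A vt (vt a₀) (vt p₀) :=
  mem_spliceDarts.2 ⟨G.mem _ S.fp.mz, S.ta, S.tp⟩

lemma mem_off (G : IsCubic A θ vt) (S : Splice A θ vt a₀ a₁ a₂ p₀ p₁ p₂) {d : D}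
    (hd : d ∈ spliceDarts A vt (vt a₀) (vt p₀))
    (h1 : d ≠ θ a₀) (h2 : d ≠ θ p₁) (h3 : d ≠ θ a₂) (h4 : d ≠ θ p₂) :
    θ d ∈ spliceDarts A vt (vt a₀) (vt p₀) := by
  obtain ⟨hA, ha, hp⟩ := mem_spliceDarts.1 hd
  refine mem_spliceDarts.2 ⟨G.mem d hA, fun h => ?_, fun h => ?_⟩
  · rcases S.fa.all _ (G.mem d hA) h with h | h | h
    · exact h1 (by rw [← h, G.inv d hA])
    · apply hp; rw [← S.link, ← h, G.inv d hA]
    · exact h3 (by rw [← h, G.inv d hA])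
  · rcases S.fp.all _ (G.mem d hA) h with h | h | h
    · apply ha
      rw [← S.fa.vy, ← G.inv _ S.fa.my, S.link, ← h, G.inv d hA]
    · exact h2 (by rw [← h, G.inv d hA])
    · exact h4 (by rw [← h, G.inv d hA])

open scoped Classical in
lemma filter_eq {a p : V} {d : D} (hd : d ∈ spliceDarts A vt a p) (P : D → Prop) :
    ((spliceDarts A vt a p).filter fun x => vt x = vt d ∧ P x) =
      A.filter fun x => vt x = vt d ∧ P x := by
  obtain ⟨-, h1, h2⟩ := mem_spliceDarts.1 hd
  ext x
  rw [Finset.mem_filter, Finset.mem_filter, mem_spliceDarts]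
  constructor
  · rintro ⟨⟨a, -⟩, b⟩; exact ⟨a, b⟩
  · rintro ⟨a, b, c⟩; exact ⟨⟨a, by rwa [b], by rwa [b]⟩, b, c⟩

lemma isEven (G : IsCubic A θ vt) (S : Splice A θ vt a₀ a₁ a₂ p₀ p₁ p₂) (E : IsEven A θ vt L)
    (h1 : L a₀ ↔ L p₁) (h2 : L a₂ ↔ L p₂) :
    IsEven (spliceDarts A vt (vt a₀) (vt p₀)) (spliceInv θ a₀ a₂ p₁ p₂) vt L := by
  classical
  have e0 := E.mem_iff G S.fa.mx
  have e1 := E.mem_iff G S.fp.my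
  have e2 := E.mem_iff G S.fa.mz
  have e3 := E.mem_iff G S.fp.mz
  refine ⟨fun d hd hL => ?_, fun d hd => ?_⟩
  · by_cases c1 : d = θ a₀
    · subst c1; rw [inv_x]; tauto
    by_cases c2 : d = θ p₁
    · subst c2; rw [inv_y G S]; tauto
    by_cases c3 : d = θ a₂
    · subst c3; rw [inv_z G S]; tauto
    by_cases c4 : d = θ p₂
    · subst c4; rw [inv_t G S]; tauto
    rw [inv_off c1 c2 c3 c4]
    exact E.symm d (mem_spliceDarts.1 hd).1 hL
  · have := E.even d (mem_spliceDarts.1 hd).1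
    rw [← filter_eq hd] at this
    exact this

lemma card_lt (S : Splice A θ vt a₀ a₁ a₂ p₀ p₁ p₂) :
    (spliceDarts A vt (vt a₀) (vt p₀)).card < A.card := by
  refine Finset.card_lt_card (Finset.ssubset_iff_of_subset ?_ |>.2 ⟨a₀, S.fa.mx, ?_⟩)
  · intro x hx; exact (mem_spliceDarts.1 hx).1
  · intro h; exact (mem_spliceDarts.1 h).2.1 rfl

lemma sum_eq (G : IsCubic A θ vt) (S : Splice A θ vt a₀ a₁ a₂ p₀ p₁ p₂) :
    ∃ B ⊆ spliceDarts A vt (vt a₀) (vt p₀),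
      (∀ d ∈ B, spliceInv θ a₀ a₂ p₁ p₂ d = θ d ∧ θ d ∈ spliceDarts A vt (vt a₀) (vt p₀)) ∧
      (∀ f : D → ℕ, ∑ d ∈ spliceDarts A vt (vt a₀) (vt p₀), f d =
        ∑ d ∈ B, f d + (f (θ a₀) + (f (θ a₂) + (f (θ p₁) + f (θ p₂))))) ∧
      (∀ f : D → ℕ, ∑ d ∈ A, f d = ∑ d ∈ spliceDarts A vt (vt a₀) (vt p₀), f d +
        (f a₀ + (f a₁ + f a₂) + (f p₀ + (f p₁ + f p₂)))) := by
  classical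
  obtain ⟨h1, h2, h3, h4, h5, h6⟩ := S.distinct G
  have hsub : ({θ a₀, θ a₂, θ p₁, θ p₂} : Finset D) ⊆ spliceDarts A vt (vt a₀) (vt p₀) := by
    intro d hd
    simp only [Finset.mem_insert, Finset.mem_singleton] at hd
    rcases hd with rfl | rfl | rfl | rfl
    exacts [S.mem_x G, S.mem_z G, S.mem_y G, S.mem_t G]
  refine ⟨spliceDarts A vt (vt a₀) (vt p₀) \ {θ a₀, θ a₂, θ p₁, θ p₂},
    Finset.sdiff_subset, ?_, ?_, ?_⟩
  · intro d hd
    simp only [Finset.mem_sdiff, Finset.mem_insert, Finset.mem_singleton, not_or] at hd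
    obtain ⟨hd, c1, c2, c3, c4⟩ := hd
    exact ⟨inv_off c1 c3 c2 c4, S.mem_off G hd c1 c3 c2 c4⟩
  · intro f
    rw [← Finset.sum_sdiff hsub, Finset.sum_insert (by simp [h1, h2, h3]),
      Finset.sum_insert (by simp [h4, h5]), Finset.sum_insert (by simp [h6]),
      Finset.sum_singleton]
  · intro f
    have e : spliceDarts A vt (vt a₀) (vt p₀) =
        A \ ((A.filter fun d => vt d = vt a₀) ∪ (A.filter fun d => vt d = vt p₀)) := by
      ext d
      simp only [mem_spliceDarts, Finset.mem_sdiff, Finset.mem_union, Finset.mem_filter]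
      tauto
    have hdis : Disjoint (A.filter fun d => vt d = vt a₀) (A.filter fun d => vt d = vt p₀) := by
      rw [Finset.disjoint_filter]
      intro d _ h h'
      exact S.ap (by rw [← h, ← h'])
    have hs : ((A.filter fun d => vt d = vt a₀) ∪ (A.filter fun d => vt d = vt p₀)) ⊆ A :=
      Finset.union_subset (Finset.filter_subset _ _) (Finset.filter_subset _ _)
    rw [← Finset.sum_sdiff hs, ← e, Finset.sum_union hdis]
    have ea : (A.filter fun d => vt d = vt a₀) = {a₀, a₁, a₂} := by
      have := S.fa.filter_eq; convert this
    have ep : (A.filter fun d => vt d = vt p₀) = {p₀, p₁, p₂} := by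
      have := S.fp.filter_eq; convert this
    rw [ea, ep, Finset.sum_insert (by simp [S.fa.xy, S.fa.xz]),
      Finset.sum_insert (by simp [S.fa.yz]), Finset.sum_singleton,
      Finset.sum_insert (by simp [S.fp.xy, S.fp.xz]),
      Finset.sum_insert (by simp [S.fp.yz]), Finset.sum_singleton]

/-- The sizes of cuts before and after splicing. -/
lemma cut_formula (G : IsCubic A θ vt) (S : Splice A θ vt a₀ a₁ a₂ p₀ p₁ p₂) (U : V → Prop) :
    ∃ N : ℕ, cutCard (spliceDarts A vt (vt a₀) (vt p₀)) (spliceInv θ a₀ a₂ p₁ p₂) vt U =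
        N + diffCount (U (vt (θ a₀))) (U (vt (θ p₁))) +
          diffCount (U (vt (θ a₂))) (U (vt (θ p₂))) ∧
      ∀ α β : Prop, cutCard A θ vt (assign U (vt a₀) (vt p₀) α β) =
        N + diffCount (U (vt (θ a₀))) α + diffCount α β + diffCount β (U (vt (θ p₁))) +
          diffCount α (U (vt (θ a₂))) + diffCount β (U (vt (θ p₂))) := by
  classical
  obtain ⟨B, hB, hθ, s1, s2⟩ := S.sum_eq G
  have hpair : ∀ P Q : Prop, (if P ∧ ¬ Q then 1 else 0) + (if Q ∧ ¬ P then 1 else 0) =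
      diffCount P Q := by
    intro P Q
    by_cases hP : P <;> by_cases hQ : Q <;> simp [diffCount, hP, hQ]
  refine ⟨(B.filter fun d => U (vt d) ∧ ¬ U (vt (θ d))).card, ?_, fun α β => ?_⟩
  · have e : cutCard (spliceDarts A vt (vt a₀) (vt p₀)) (spliceInv θ a₀ a₂ p₁ p₂) vt U =
        ((spliceDarts A vt (vt a₀) (vt p₀)).filter fun d =>
          U (vt d) ∧ ¬ U (vt (spliceInv θ a₀ a₂ p₁ p₂ d))).card := by unfold cutCard; congr
    rw [e, Finset.card_filter, s1, inv_x, inv_y G S, inv_z G S, inv_t G S, Finset.card_filter]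
    have : ∑ d ∈ B, (if U (vt d) ∧ ¬ U (vt (spliceInv θ a₀ a₂ p₁ p₂ d)) then 1 else 0) =
        ∑ d ∈ B, (if U (vt d) ∧ ¬ U (vt (θ d)) then 1 else 0) :=
      Finset.sum_congr rfl fun d hd => by rw [(hθ d hd).1]
    rw [this, ← hpair, ← hpair]
    ring
  · set W := assign U (vt a₀) (vt p₀) α β with hW
    have e : cutCard A θ vt W = (A.filter fun d => W (vt d) ∧ ¬ W (vt (θ d))).card := by
      unfold cutCard; congr
    have hoff : ∀ d ∈ spliceDarts A vt (vt a₀) (vt p₀), W (vt d) = U (vt d) := fun d hd =>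
      propext (assign_off (mem_spliceDarts.1 hd).2.1 (mem_spliceDarts.1 hd).2.2)
    have ha : W (vt a₀) = α := propext assign_left
    have hp : W (vt p₀) = β := propext (assign_right S.ap)
    have : ∑ d ∈ B, (if W (vt d) ∧ ¬ W (vt (θ d)) then 1 else 0) =
        ∑ d ∈ B, (if U (vt d) ∧ ¬ U (vt (θ d)) then 1 else 0) :=
      Finset.sum_congr rfl fun d hd => by rw [hoff _ (hB hd), hoff _ (hθ d hd).2]
    have hl : θ p₀ = a₁ := by rw [← S.link, G.inv _ S.fa.my]
    rw [e, Finset.card_filter, s2, s1, this, G.inv _ S.fa.mx, G.inv _ S.fa.mz, G.inv _ S.fp.my,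
      G.inv _ S.fp.mz, Finset.card_filter, S.link, hl, S.fa.vy, S.fa.vz, S.fp.vy, S.fp.vz, ha, hp,
      hoff _ (S.mem_x G), hoff _ (S.mem_y G), hoff _ (S.mem_z G), hoff _ (S.mem_t G),
      ← hpair, ← hpair, ← hpair, ← hpair, ← hpair]
    ring

/-- Splicing preserves being cubic and bridgeless if two types of 3-edge-cuts do not occur. -/
lemma isCubic (G : IsCubic A θ vt) (S : Splice A θ vt a₀ a₁ a₂ p₀ p₁ p₂)
    (H1 : ∀ U : V → Prop, U (vt a₀) → U (vt p₀) → U (vt (θ a₀)) → U (vt (θ p₁)) →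
      ¬ U (vt (θ a₂)) → ¬ U (vt (θ p₂)) → cutCard A θ vt U ≠ 3)
    (H2 : ∀ U : V → Prop, U (vt a₀) → U (vt p₀) → ¬ U (vt (θ a₀)) → ¬ U (vt (θ p₁)) →
      U (vt (θ a₂)) → U (vt (θ p₂)) → cutCard A θ vt U ≠ 3) :
    IsCubic (spliceDarts A vt (vt a₀) (vt p₀)) (spliceInv θ a₀ a₂ p₁ p₂) vt := by
  classical
  obtain ⟨h1, h2, h3, h4, h5, h6⟩ := S.distinct G
  have main : ∀ d ∈ spliceDarts A vt (vt a₀) (vt p₀),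
      spliceInv θ a₀ a₂ p₁ p₂ d ∈ spliceDarts A vt (vt a₀) (vt p₀) ∧
      spliceInv θ a₀ a₂ p₁ p₂ (spliceInv θ a₀ a₂ p₁ p₂ d) = d ∧
      spliceInv θ a₀ a₂ p₁ p₂ d ≠ d := by
    intro d hd
    by_cases c1 : d = θ a₀
    · subst c1; rw [inv_x, inv_y G S]; exact ⟨S.mem_y G, rfl, h2.symm⟩
    by_cases c2 : d = θ p₁
    · subst c2; rw [inv_y G S, inv_x]; exact ⟨S.mem_x G, rfl, h2⟩
    by_cases c3 : d = θ a₂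
    · subst c3; rw [inv_z G S, inv_t G S]; exact ⟨S.mem_t G, rfl, h5.symm⟩
    by_cases c4 : d = θ p₂
    · subst c4; rw [inv_t G S, inv_z G S]; exact ⟨S.mem_z G, rfl, h5⟩
    have hA := (mem_spliceDarts.1 hd).1
    have hne : ∀ x ∈ A, (vt x = vt a₀ ∨ vt x = vt p₀) → θ d ≠ θ x := fun x hx hv h => by
      have : d = x := by rw [← G.inv d hA, h, G.inv x hx]
      subst this
      rcases hv with h | h
      exacts [(mem_spliceDarts.1 hd).2.1 h, (mem_spliceDarts.1 hd).2.2 h]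
    rw [inv_off c1 c2 c3 c4, inv_off (hne _ S.fa.mx (Or.inl rfl)) (hne _ S.fp.my (Or.inr S.fp.vy))
      (hne _ S.fa.mz (Or.inl S.fa.vz)) (hne _ S.fp.mz (Or.inr S.fp.vz))]
    exact ⟨S.mem_off G hd c1 c2 c3 c4, G.inv d hA, G.ne d hA⟩
  refine ⟨fun d hd => (main d hd).1, fun d hd => (main d hd).2.1, fun d hd => (main d hd).2.2,
    fun d hd => ?_, fun U hU => ?_⟩
  · have := G.three d (mem_spliceDarts.1 hd).1
    have e := filter_eq hd fun _ => True
    simp only [and_true] at e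
    rw [← e] at this
    exact this
  · obtain ⟨N, e1, e2⟩ := S.cut_formula G U
    rw [hU] at e1
    have bT := G.bridgeless (assign U (vt a₀) (vt p₀) True True)
    have bF := G.bridgeless (assign U (vt a₀) (vt p₀) False False)
    have K1 := H1 (assign U (vt a₀) (vt p₀) True True)
    have K2 := H2 (assign U (vt a₀) (vt p₀) True True)
    rw [assign_left, assign_right S.ap, assign_off S.xa S.xp, assign_off S.ya S.yp,
      assign_off S.za S.zp, assign_off S.ta S.tp] at K1 K2
    rw [e2] at bT bF K1 K2
    by_cases c1 : U (vt (θ a₀)) <;> by_cases c2 : U (vt (θ p₁)) <;>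
      by_cases c3 : U (vt (θ a₂)) <;> by_cases c4 : U (vt (θ p₂)) <;>
      simp [c1, c2, c3, c4, diffCount] at e1 bT bF K1 K2 <;> omega

/-- Perfect matchings avoiding `θ a₀` extend to the graph before splicing. -/
lemma lift (G : IsCubic A θ vt) (S : Splice A θ vt a₀ a₁ a₂ p₀ p₁ p₂) {M' : D → Prop}
    (P : IsPM (spliceDarts A vt (vt a₀) (vt p₀)) (spliceInv θ a₀ a₂ p₁ p₂) vt M')
    (hx : ¬ M' (θ a₀)) :
    ∃ M, IsPM A θ vt M ∧ (∀ d, M' d → M d) ∧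
      ((M' (θ a₂) ∧ M a₂ ∧ M p₂) ∨ (¬ M' (θ a₂) ∧ M a₁ ∧ M p₀)) := by
  classical
  have hy : ¬ M' (θ p₁) := fun h => hx (by simpa [inv_y G S] using P.symm _ h)
  have hzt : M' (θ a₂) ↔ M' (θ p₂) :=
    ⟨fun h => by simpa [inv_z G S] using P.symm _ h,
      fun h => by simpa [inv_t G S] using P.symm _ h⟩
  have hl : θ p₀ = a₁ := by rw [← S.link, G.inv _ S.fa.my]
  have hS : ∀ d, M' d → (d ≠ θ a₂ → d ≠ θ p₂ → M' (θ d)) := fun d hd h3 h4 => by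
    have h1 : d ≠ θ a₀ := fun h => hx (h ▸ hd)
    have h2 : d ≠ θ p₁ := fun h => hy (h ▸ hd)
    have := P.symm _ hd
    rwa [inv_off h1 h2 h3 h4] at this
  have hv : ∀ d, M' d → vt d ≠ vt a₀ ∧ vt d ≠ vt p₀ := fun d hd =>
    (mem_spliceDarts.1 (P.sub d hd)).2
  have ex : ∀ d ∈ A, vt d ≠ vt a₀ → vt d ≠ vt p₀ → ∃ x, M' x ∧ vt x = vt d := fun d hd h h' =>
    P.ex d (mem_spliceDarts.2 ⟨hd, h, h'⟩)
  have general : ∀ r s : D, r ∈ A → s ∈ A → vt r = vt a₀ → vt s = vt p₀ →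
      (∀ d, (M' d ∨ d = r ∨ d = s) → (M' (θ d) ∨ θ d = r ∨ θ d = s)) →
      IsPM A θ vt (fun d => M' d ∨ d = r ∨ d = s) := by
    intro r s hr hs vr vs hsym
    refine ⟨?_, hsym, ?_, ?_⟩
    · rintro d (h | rfl | rfl)
      exacts [(mem_spliceDarts.1 (P.sub d h)).1, hr, hs]
    · intro d hd
      by_cases h : vt d = vt a₀
      · exact ⟨r, by simp, by rw [vr, h]⟩
      by_cases h' : vt d = vt p₀
      · exact ⟨s, by simp, by rw [vs, h']⟩
      obtain ⟨x, hx, e⟩ := ex d hd h h'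
      exact ⟨x, Or.inl hx, e⟩
    · rintro x y (hx | rfl | rfl) (hy | rfl | rfl) e
      · exact P.uniq _ _ hx hy e
      · exact absurd (e.trans vr) (hv _ hx).1
      · exact absurd (e.trans vs) (hv _ hx).2
      · exact absurd (e.symm.trans vr) (hv _ hy).1
      · rfl
      · exact absurd (by rw [← vs, ← e, vr]) S.ap
      · exact absurd (e.symm.trans vs) (hv _ hy).2
      · exact absurd (by rw [← vs, e, vr]) S.ap
      · rfl
  by_cases hz : M' (θ a₂)
  · refine ⟨fun d => M' d ∨ d = a₂ ∨ d = p₂,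
      general a₂ p₂ S.fa.mz S.fp.mz S.fa.vz S.fp.vz ?_, fun d h => Or.inl h,
      Or.inl ⟨hz, by simp, by simp⟩⟩
    rintro d (h | rfl | rfl)
    · by_cases h3 : d = θ a₂
      · subst h3; simp [G.inv _ S.fa.mz]
      by_cases h4 : d = θ p₂
      · subst h4; simp [G.inv _ S.fp.mz]
      exact Or.inl (hS d h h3 h4)
    · exact Or.inl hz
    · exact Or.inl (hzt.1 hz)
  · refine ⟨fun d => M' d ∨ d = a₁ ∨ d = p₀,
      general a₁ p₀ S.fa.my S.fp.mx S.fa.vy rfl ?_, fun d h => Or.inl h,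
      Or.inr ⟨hz, by simp, by simp⟩⟩
    rintro d (h | rfl | rfl)
    · exact Or.inl (hS d h (fun h3 => hz (h3 ▸ h)) (fun h4 => hz (hzt.2 (h4 ▸ h))))
    · exact Or.inr (Or.inr S.link)
    · exact Or.inr (Or.inl hl)

/-- A colouring witnessing quellability after splicing extends if the five removed edges can be
dealt with. -/
lemma lift_colouring (G : IsCubic A θ vt) (S : Splice A θ vt a₀ a₁ a₂ p₀ p₁ p₂)
    {M : D → Prop} (hM : IsPM A θ vt M) {c : V → Bool} (hL : ∀ d ∈ A, L d → L (θ d))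
    (C : ∀ d ∈ spliceDarts A vt (vt a₀) (vt p₀), L d → ¬ M d →
      c (vt d) ≠ c (vt (spliceInv θ a₀ a₂ p₁ p₂ d)))
    {α β : Bool} (h0 : L a₀ → ¬ M a₀ → α ≠ c (vt (θ a₀))) (h1 : L a₁ → ¬ M a₁ → α ≠ β)
    (h2 : L a₂ → ¬ M a₂ → α ≠ c (vt (θ a₂))) (h3 : L p₁ → ¬ M p₁ → β ≠ c (vt (θ p₁)))
    (h4 : L p₂ → ¬ M p₂ → β ≠ c (vt (θ p₂))) :
    ∃ c : V → Bool, ∀ d ∈ A, L d → ¬ M d → c (vt d) ≠ c (vt (θ d)) := by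
  classical
  have hMs : ∀ d ∈ A, ¬ M d → ¬ M (θ d) := fun d hd h h' => h (by
    simpa [G.inv d hd] using hM.symm _ h')
  set k : V → Bool := fun x => if x = vt a₀ then α else if x = vt p₀ then β else c x with hk
  have ka : k (vt a₀) = α := by simp [hk]
  have kp : k (vt p₀) = β := by simp [hk, S.ap]
  have ko : ∀ x, x ≠ vt a₀ → x ≠ vt p₀ → k x = c x := fun x h h' => by simp [hk, h, h']
  have hl : θ p₀ = a₁ := by rw [← S.link, G.inv _ S.fa.my]
  have key : ∀ d ∈ A, vt d = vt a₀ ∨ vt d = vt p₀ → L d → ¬ M d → k (vt d) ≠ k (vt (θ d)) := by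
    rintro d hd (h | h) hLd hMd
    · rcases S.fa.all d hd h with rfl | rfl | rfl
      · rw [ka, ko _ S.xa S.xp]; exact h0 hLd hMd
      · rw [S.fa.vy, ka, S.link, kp]; exact h1 hLd hMd
      · rw [S.fa.vz, ka, ko _ S.za S.zp]; exact h2 hLd hMd
    · rcases S.fp.all d hd h with rfl | rfl | rfl
      · rw [kp, hl, S.fa.vy, ka]
        refine (h1 ?_ ?_).symm
        · rw [← hl]; exact hL _ hd hLd
        · rw [← hl]; exact hMs _ hd hMd
      · rw [S.fp.vy, kp, ko _ S.ya S.yp]; exact h3 hLd hMd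
      · rw [S.fp.vz, kp, ko _ S.ta S.tp]; exact h4 hLd hMd
  refine ⟨k, fun d hd hLd hMd => ?_⟩
  by_cases hda : vt d = vt a₀ ∨ vt d = vt p₀
  · exact key d hd hda hLd hMd
  by_cases hda' : vt (θ d) = vt a₀ ∨ vt (θ d) = vt p₀
  · have := key (θ d) (G.mem d hd) hda' (hL d hd hLd) (hMs d hd hMd)
    rw [G.inv d hd] at this
    exact this.symm
  rw [not_or] at hda hda'
  have hdm : d ∈ spliceDarts A vt (vt a₀) (vt p₀) := mem_spliceDarts.2 ⟨hd, hda⟩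
  have := C d hdm hLd hMd
  rw [ko _ hda.1 hda.2, ko _ hda'.1 hda'.2]
  rwa [inv_off] at this
  · rintro rfl; rw [G.inv _ S.fa.mx] at hda'; exact hda'.1 rfl
  · rintro rfl; rw [G.inv _ S.fp.my] at hda'; exact hda'.2 S.fp.vy
  · rintro rfl; rw [G.inv _ S.fa.mz] at hda'; exact hda'.1 S.fa.vz
  · rintro rfl; rw [G.inv _ S.fp.mz] at hda'; exact hda'.2 S.fp.vz

end Splice

end Splicing

section Component

/-- A cycle minus an edge is properly 2-colourable; here darts `x` and `π x` share a vertex and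
`θ x` is the reverse of `x`. -/
lemma exists_colouring_of_orbit {S V : Type*} [Finite S] {θ π : S → S} {vt : S → V}
    (hθ : ∀ x, θ (θ x) = x) (hθ' : ∀ x, θ x ≠ x) (hπ : ∀ x, π (π x) = x) (hπ' : ∀ x, π x ≠ x)
    (hv : ∀ x y, vt x = vt y ↔ x = y ∨ x = π y) (s : S) :
    ∃ (K : V → Prop) (c : V → Bool), K (vt s) ∧ K (vt (θ s)) ∧
      (∀ d, K (vt d) → K (vt (θ d))) ∧
      ∀ d, K (vt d) → d ≠ s → d ≠ θ s → c (vt d) ≠ c (vt (θ d)) := by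
  classical
  have hinj : Function.Injective fun x => θ (π x) := fun x y h => by
    have h1 : π x = π y := by rw [← hθ (π x), ← hθ (π y)]; exact congrArg θ h
    rw [← hπ x, h1, hπ]
  set x : ℕ → S := fun j => (fun x => θ (π x))^[j] s with hx
  have x0 : x 0 = s := rfl
  have xs : ∀ j, x (j + 1) = θ (π (x j)) := fun j => by
    simp only [hx, Function.iterate_succ_apply']
  have xs' : ∀ j, θ (x (j + 1)) = π (x j) := fun j => by rw [xs, hθ]
  obtain ⟨n, hn, hp⟩ := Function.mem_periodicPts.1 (hinj.mem_periodicPts s)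
  have xn : x n = s := hp
  obtain ⟨m, rfl⟩ : ∃ m, n = m + 1 := ⟨n - 1, by omega⟩
  have vπ : ∀ y, vt (π y) = vt y := fun y => (hv _ _).2 (Or.inr rfl)
  have hs : vt (θ s) = vt (x m) := by rw [← xn, xs', vπ]
  have closed : ∀ d, (∃ j, vt (x j) = vt d) → ∃ j, vt (x j) = vt (θ d) := by
    rintro d ⟨j, hj⟩
    rcases (hv _ _).1 hj.symm with rfl | rfl
    · rcases j with _ | j
      · exact ⟨m, hs.symm⟩
      · exact ⟨j, by rw [xs', vπ]⟩
    · exact ⟨j + 1, by rw [xs]⟩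
  set ν : V → ℕ := fun v => if h : ∃ j, vt (x j) = v then Nat.find h else 0 with hν
  have νspec : ∀ v, (∃ j, vt (x j) = v) → vt (x (ν v)) = v := fun v h => by
    simp only [hν, dif_pos h]; exact Nat.find_spec h
  have νmin : ∀ v j, vt (x j) = v → ν v ≤ j := fun v j h => by
    have h' : ∃ j, vt (x j) = v := ⟨j, h⟩
    simp only [hν, dif_pos h']; exact Nat.find_min' h' h
  have main : ∀ d, d ≠ s → d ≠ θ s → d = x (ν (vt d)) →
      decide (Even (ν (vt d))) ≠ decide (Even (ν (vt (θ d)))) := by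
    intro d h1 h2 hd
    obtain ⟨j, hj⟩ : ∃ j, ν (vt d) = j + 1 := by
      rcases h : ν (vt d) with _ | j
      · rw [h] at hd; exact absurd hd h1
      · exact ⟨j, rfl⟩
    rw [hj] at hd
    have hθd : vt (θ d) = vt (x j) := by rw [hd, xs', vπ]
    have le := νmin _ j hθd.symm
    have hsp := νspec _ ⟨j, hθd.symm⟩
    rw [hθd] at hsp le ⊢
    set i := ν (vt (x j)) with hi
    have hij : i = j := by
      by_contra hne
      rcases (hv _ _).1 hsp with h | h
      · have := νmin (vt d) (i + 1) (by rw [xs, h, ← xs, ← hd])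
        omega
      · have h' : d = θ (x i) := by rw [hd, xs, h]
        rcases hi0 : i with _ | k
        · rw [hi0] at h'; exact h2 h'
        · rw [hi0] at h'
          have := νmin (vt d) k (by rw [h', xs', vπ])
          omega
    rw [hj, hij]
    by_cases hev : Even j <;> simp [hev, Nat.even_add_one]
  refine ⟨fun v => ∃ j, vt (x j) = v, fun v => decide (Even (ν v)), ⟨0, rfl⟩, ⟨m, hs.symm⟩,
    closed, fun d hd h1 h2 => ?_⟩
  rcases (hv _ _).1 (νspec _ hd).symm with h | h
  · exact main d h1 h2 h
  · set j := ν (vt d) with hj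
    have hθd : θ d = x (j + 1) := by rw [xs, h]
    have le := νmin (vt (θ d)) (j + 1) (by rw [hθd])
    have hsp := νspec _ (closed d hd)
    rcases (hv _ _).1 hsp.symm with h' | h'
    · have := main (θ d) (fun e => h2 (by rw [← e, hθ])) (fun e => h1 (by rw [← hθ d, e, hθ])) h'
      rw [hθ] at this
      exact this.symm
    · exfalso
      set i := ν (vt (θ d)) with hi
      have e : d = x (i + 1) := by rw [← hθ d, h', ← xs]
      have := νmin (vt d) (i + 1) (by rw [← e])
      have hne : i ≠ j + 1 := fun e' => by
        rw [e', ← hθd] at h'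
        exact hπ' _ h'.symm
      rcases Nat.lt_or_ge j (i + 1) with hlt | hge
      · have : i + 1 = j + 1 ∨ i + 1 = j := by omega
        rcases this with e' | e'
        · rw [e', ← hθd] at e; exact hθ' d e.symm
        · omega
      · have e' : i + 1 = j := by omega
        rw [e'] at e
        rw [← e] at h
        exact hπ' d h.symm

variable {D : Type*} {A : Finset D} {θ : D → D} {vt : D → V} {L : D → Prop}

/-- The vertex set of the component of `L` containing the vertex `v`. -/
def Comp (A : Finset D) (θ : D → D) (vt : D → V) (L : D → Prop) (v x : V) : Prop :=
  ∀ K : V → Prop, (∀ d ∈ A, L d → K (vt d) → K (vt (θ d))) → K v → K x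

lemma Comp.refl {v : V} : Comp A θ vt L v v := fun _ _ h => h

lemma Comp.step {v : V} {d : D} (hd : d ∈ A) (hL : L d) (h : Comp A θ vt L v (vt d)) :
    Comp A θ vt L v (vt (θ d)) := fun K hK hv => hK d hd hL (h K hK hv)

lemma Comp.step_iff (G : IsCubic A θ vt) (E : IsEven A θ vt L) {v : V} {d : D} (hd : d ∈ A)
    (hL : L d) : Comp A θ vt L v (vt (θ d)) ↔ Comp A θ vt L v (vt d) :=
  ⟨fun h => by simpa [G.inv d hd] using h.step (G.mem d hd) (E.symm d hd hL), fun h => h.step hd hL⟩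

/-- Removing a component of `L` leaves an even set. -/
lemma IsEven.diff_comp (G : IsCubic A θ vt) (E : IsEven A θ vt L) (v : V) :
    IsEven A θ vt (fun d => L d ∧ ¬ Comp A θ vt L v (vt d)) := by
  classical
  refine ⟨fun d hd h => ⟨E.symm d hd h.1, by rw [Comp.step_iff G E hd h.1]; exact h.2⟩,
    fun d hd => ?_⟩
  by_cases h : Comp A θ vt L v (vt d)
  · have e : (A.filter fun x => vt x = vt d ∧ L x ∧ ¬ Comp A θ vt L v (vt x)) = ∅ := by
      rw [Finset.filter_eq_empty_iff]
      rintro x - ⟨e, -, hn⟩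
      exact hn (e ▸ h)
    have : Even (A.filter fun x => vt x = vt d ∧ L x ∧ ¬ Comp A θ vt L v (vt x)).card := by
      rw [e]; simp
    convert this
  · have e : (A.filter fun x => vt x = vt d ∧ L x ∧ ¬ Comp A θ vt L v (vt x)) =
        A.filter fun x => vt x = vt d ∧ L x := by
      ext x
      simp only [Finset.mem_filter]
      constructor
      · rintro ⟨a, b, c, -⟩; exact ⟨a, b, c⟩
      · rintro ⟨a, b, c⟩; exact ⟨a, b, c, b ▸ h⟩
    have := E.even d hd
    rw [← e] at this
    convert this

lemma IsEven.exists_partner (G : IsCubic A θ vt) (E : IsEven A θ vt L) {d : D} (hd : d ∈ A)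
    (hL : L d) : ∃ y ∈ A, L y ∧ vt y = vt d ∧ y ≠ d ∧
      ∀ w ∈ A, L w → vt w = vt d → w = d ∨ w = y := by
  obtain ⟨y, z, F⟩ := G.fiber hd
  have h := (E.iff F).1 hL
  by_cases hy : L y
  · refine ⟨y, F.my, hy, F.vy, F.xy.symm, fun w hw hLw e => ?_⟩
    rcases F.all w hw e with r | r | r
    · exact Or.inl r
    · exact Or.inr r
    · exact absurd (r ▸ hLw) (h.1 hy)
  · have hz : L z := by by_contra hz; exact hy (h.2 hz)
    refine ⟨z, F.mz, hz, F.vz, F.xz.symm, fun w hw hLw e => ?_⟩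
    rcases F.all w hw e with r | r | r
    · exact Or.inl r
    · exact absurd (r ▸ hLw) hy
    · exact Or.inr r

/-- A component of `L` minus an edge is properly 2-colourable. -/
lemma exists_colouring_comp (G : IsCubic A θ vt) (E : IsEven A θ vt L) {v : V} {d₀ : D}
    (h₀ : d₀ ∈ A) (hL₀ : L d₀) (hC : Comp A θ vt L v (vt d₀)) :
    ∃ c : V → Bool, ∀ d ∈ A, L d → Comp A θ vt L v (vt d) → d ≠ d₀ → d ≠ θ d₀ →
      c (vt d) ≠ c (vt (θ d)) := by
  classical
  have : ∀ d : {d // d ∈ A ∧ L d}, ∃ y : {d // d ∈ A ∧ L d}, vt y.1 = vt d.1 ∧ y ≠ d ∧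
      ∀ w : {d // d ∈ A ∧ L d}, vt w.1 = vt d.1 → w = d ∨ w = y := by
    rintro ⟨d, hd, hL⟩
    obtain ⟨y, hy, hLy, e, hne, hall⟩ := E.exists_partner G hd hL
    refine ⟨⟨y, hy, hLy⟩, e, fun h => hne (congrArg Subtype.val h), ?_⟩
    rintro ⟨w, hw, hLw⟩ e
    rcases hall w hw hLw e with h | h
    exacts [Or.inl (Subtype.ext h), Or.inr (Subtype.ext h)]
  choose π p1 p2 p3 using this
  let θS : {d // d ∈ A ∧ L d} → {d // d ∈ A ∧ L d} := fun d =>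
    ⟨θ d.1, G.mem _ d.2.1, E.symm _ d.2.1 d.2.2⟩
  have hfin : Finite {d // d ∈ A ∧ L d} :=
    Finite.of_injective (fun d => (⟨d.1, d.2.1⟩ : A)) fun a b h =>
      Subtype.ext (congrArg (fun z : A => z.1) h)
  obtain ⟨K, c, k1, k2, k3, k4⟩ := exists_colouring_of_orbit (θ := θS) (π := π)
    (vt := fun d => vt d.1) (fun d => Subtype.ext (G.inv _ d.2.1))
    (fun d h => G.ne _ d.2.1 (congrArg Subtype.val h))
    (fun d => by
      rcases p3 (π d) d (p1 d).symm with h | h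
      · exact absurd h.symm (p2 d)
      · exact h.symm)
    p2
    (fun x y => ⟨fun h => p3 y x h, by
      rintro (h | h)
      · rw [h]
      · rw [h]; exact p1 y⟩) ⟨d₀, h₀, hL₀⟩
  refine ⟨c, fun d hd hL hCd h1 h2 => ?_⟩
  refine k4 ⟨d, hd, hL⟩ ?_ (fun h => h1 (congrArg Subtype.val h))
    (fun h => h2 (congrArg Subtype.val h))
  have kv : K v := by
    by_contra hv
    refine hC (fun x => ¬ K x) (fun d hd hL h h' => h ?_) hv k1
    have := k3 ⟨θ d, G.mem _ hd, E.symm _ hd hL⟩ h'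
    simpa [θS, G.inv _ hd] using this
  exact hCd K (fun d hd hL h => k3 ⟨d, hd, hL⟩ h) kv

/-- It suffices to quell `L` minus one component, if the matching meets that component. -/
lemma Quellable.of_diff_comp (G : IsCubic A θ vt) (E : IsEven A θ vt L) {v : V} {e d₀ : D}
    {M : D → Prop} (P : IsPM A θ vt M) (he : M e) (hL₀ : L d₀)
    (hC : Comp A θ vt L v (vt d₀)) (hM : M d₀)
    (hc : ∃ c : V → Bool, ∀ d ∈ A, L d ∧ ¬ Comp A θ vt L v (vt d) → ¬ M d →
      c (vt d) ≠ c (vt (θ d))) :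
    Quellable A θ vt L e := by
  classical
  obtain ⟨c, hc⟩ := hc
  obtain ⟨c', hc'⟩ := exists_colouring_comp G E (P.sub _ hM) hL₀ hC
  refine ⟨M, fun x => if Comp A θ vt L v x then c' x else c x, P, he, fun d hd hL hMd => ?_⟩
  by_cases h : Comp A θ vt L v (vt d)
  · simp only [h, h.step hd hL, if_true]
    refine hc' d hd hL h (fun e => hMd (e ▸ hM)) (fun e => hMd ?_)
    rw [e]; exact P.symm _ hM
  · have h' : ¬ Comp A θ vt L v (vt (θ d)) := by rwa [Comp.step_iff G E hd hL]
    simp only [h, h', if_false]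
    exact hc d hd ⟨hL, h⟩ hMd

end Component

section Base

variable {D : Type*} {A : Finset D} {θ : D → D} {vt : D → V} {L : D → Prop}

open scoped Classical in
/-- The number of edges joining `x` and `y` (for `x ≠ y`). -/
noncomputable def mult (A : Finset D) (θ : D → D) (vt : D → V) (x y : V) : ℕ :=
  (A.filter fun d => vt d = x ∧ vt (θ d) = y).card

lemma mult_comm (G : IsCubic A θ vt) (x y : V) : mult A θ vt x y = mult A θ vt y x := by
  classical
  unfold mult
  refine Finset.card_bij' (fun d _ => θ d) (fun d _ => θ d) ?_ ?_ ?_ ?_ <;>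
    · intro d hd
      simp only [Finset.mem_filter] at hd ⊢
      simp [G.inv d hd.1, G.mem d hd.1, hd.2.1, hd.2.2]

lemma mult_self (G : IsCubic A θ vt) (x : V) : mult A θ vt x x = 0 := by
  classical
  unfold mult
  rw [Finset.card_eq_zero, Finset.filter_eq_empty_iff]
  rintro d hd ⟨h, h'⟩
  exact G.no_loop hd (h'.trans h.symm)

lemma mult_pos {d : D} (hd : d ∈ A) : 0 < mult A θ vt (vt d) (vt (θ d)) := by
  classical
  exact Finset.card_pos.2 ⟨d, by simp [hd]⟩

lemma sum_mult (G : IsCubic A θ vt) {W : Finset V} (hW : ∀ d ∈ A, vt d ∈ W) {d : D}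
    (hd : d ∈ A) : ∑ y ∈ W, mult A θ vt (vt d) y = 3 := by
  classical
  have h := G.three d hd
  have h' : (A.filter fun x => vt x = vt d).card = 3 := by convert h
  rw [Finset.card_eq_sum_card_fiberwise (f := fun x => vt (θ x)) (t := W)] at h'
  · rw [← h']
    refine Finset.sum_congr rfl fun y _ => ?_
    rw [Finset.filter_filter]
    unfold mult
    congr
  · intro x hx
    simp only [Finset.coe_filter, Set.mem_ofPred_eq] at hx
    exact hW _ (G.mem x hx.1)

open scoped Classical in
lemma card_eq_three_mul (G : IsCubic A θ vt) : A.card = 3 * (A.image vt).card := by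
  rw [Finset.card_eq_sum_card_image vt A, Finset.sum_const_nat (m := 3)]
  · ring
  · intro x hx
    obtain ⟨d, hd, rfl⟩ := Finset.mem_image.1 hx
    have := G.three d hd
    convert this

/-- Bridgeless cubic graphs on fewer than six vertices are quellable. -/
lemma Quellable.of_card_lt (G : IsCubic A θ vt) (hA : A.card < 18) {e : D} (he : e ∈ A) :
    Quellable A θ vt L e := by
  classical
  set W := A.image vt with hW
  have hc := card_eq_three_mul G
  have hc' : A.card = 3 * W.card := by rw [hc]
  have hev := even_card_of_involution (s := A) θ G.mem G.inv G.ne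
  have hmem : ∀ d ∈ A, vt d ∈ W := fun d hd => Finset.mem_image_of_mem _ hd
  set u := vt e with hu
  set v := vt (θ e) with hv
  have huv : v ≠ u := G.no_loop he
  have hu' : u ∈ W := hmem _ he
  have hv' : v ∈ W := hmem _ (G.mem _ he)
  have hsub : ({u, v} : Finset V) ⊆ W := by
    intro x hx
    simp only [Finset.mem_insert, Finset.mem_singleton] at hx
    rcases hx with rfl | rfl <;> assumption
  have hcard : (W \ {u, v}).card = W.card - 2 := by
    rw [Finset.card_sdiff_of_subset hsub, Finset.card_pair huv.symm]
  have h24 : W.card = 2 ∨ W.card = 4 := by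
    have h2 : 2 ≤ W.card := by
      have := Finset.card_le_card hsub
      rwa [Finset.card_pair huv.symm] at this
    rw [Nat.even_iff] at hev
    omega
  rcases h24 with h2 | h4
  · rw [h2] at hcard
    have hWe : ∀ d ∈ A, vt d = u ∨ vt d = v := fun d hd => by
      by_contra hn
      have : vt d ∈ W \ {u, v} := by simpa [hmem d hd] using hn
      rw [Finset.card_eq_zero.1 hcard] at this
      simp at this
    refine ⟨fun d => d = e ∨ d = θ e, fun x => decide (x = u), ⟨?_, ?_, ?_, ?_⟩, Or.inl rfl, ?_⟩
    · rintro d (rfl | rfl)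
      exacts [he, G.mem _ he]
    · rintro d (rfl | rfl)
      · simp
      · simp [G.inv _ he]
    · intro d hd
      rcases hWe d hd with h | h
      exacts [⟨e, Or.inl rfl, h.symm⟩, ⟨θ e, Or.inr rfl, h.symm⟩]
    · rintro x y (rfl | rfl) (rfl | rfl) h
      exacts [rfl, absurd h.symm huv, absurd h huv, rfl]
    · intro d hd _ _
      have hn := G.no_loop hd
      rcases hWe d hd with h | h <;> rcases hWe _ (G.mem d hd) with h' | h'
      · exact absurd (h'.trans h.symm) hn
      · simp [h, h', huv]
      · simp [h, h', huv]
      · exact absurd (h'.trans h.symm) hn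
  · rw [h4] at hcard
    obtain ⟨a, b, hab, hWab⟩ := Finset.card_eq_two.1 hcard
    have key : ∀ x, (x ∈ W ∧ x ≠ u ∧ x ≠ v) ↔ (x = a ∨ x = b) := fun x => by
      have := congrArg (fun s => x ∈ s) hWab
      simpa [not_or] using this
    obtain ⟨haW, hau, hav⟩ := (key a).2 (Or.inl rfl)
    obtain ⟨hbW, hbu, hbv⟩ := (key b).2 (Or.inr rfl)
    have hWe : ∀ x ∈ W, x = u ∨ x = v ∨ x = a ∨ x = b := fun x hx => by
      by_cases h1 : x = u
      · exact Or.inl h1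
      by_cases h2 : x = v
      · exact Or.inr (Or.inl h2)
      exact Or.inr (Or.inr ((key x).1 ⟨hx, h1, h2⟩))
    have hWs : W = {u, v, a, b} := by
      ext x
      simp only [Finset.mem_insert, Finset.mem_singleton]
      refine ⟨hWe x, ?_⟩
      rintro (rfl | rfl | rfl | rfl) <;> assumption
    have hsum : ∀ x ∈ W, mult A θ vt x u + (mult A θ vt x v + (mult A θ vt x a +
        mult A θ vt x b)) = 3 := fun x hx => by
      obtain ⟨d, hd, rfl⟩ := Finset.mem_image.1 hx
      have := sum_mult G hmem hd
      rwa [hWs, Finset.sum_insert (by simp [huv.symm, hau.symm, hbu.symm]),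
        Finset.sum_insert (by simp [hav.symm, hbv.symm]), Finset.sum_insert (by simp [hab]),
        Finset.sum_singleton] at this
    have su := hsum u hu'
    have sv := hsum v hv'
    have sa := hsum a haW
    have sb := hsum b hbW
    rw [mult_self G] at su sv sa sb
    rw [mult_comm G v u] at sv
    rw [mult_comm G a u, mult_comm G a v] at sa
    rw [mult_comm G b u, mult_comm G b v, mult_comm G b a] at sb
    have hpos : 0 < mult A θ vt u v := mult_pos he
    have hgpos : 0 < mult A θ vt a b := by omega
    obtain ⟨g, hg⟩ := Finset.card_pos.1 hgpos
    simp only [Finset.mem_filter] at hg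
    obtain ⟨hgA, hga, hgb⟩ := hg
    set M : D → Prop := fun d => d = e ∨ d = θ e ∨ d = g ∨ d = θ g with hM
    have P : IsPM A θ vt M := by
      refine ⟨?_, ?_, ?_, ?_⟩
      · rintro d (rfl | rfl | rfl | rfl)
        exacts [he, G.mem _ he, hgA, G.mem _ hgA]
      · rintro d (rfl | rfl | rfl | rfl)
        · simp [hM]
        · simp [hM, G.inv _ he]
        · simp [hM]
        · simp [hM, G.inv _ hgA]
      · intro d hd
        rcases hWe _ (hmem d hd) with h | h | h | h
        exacts [⟨e, by simp [hM], h.symm⟩, ⟨θ e, by simp [hM], h.symm⟩,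
          ⟨g, by simp [hM], hga.trans h.symm⟩, ⟨θ g, by simp [hM], hgb.trans h.symm⟩]
      · have d1 : u ≠ v := huv.symm
        rintro x y (rfl | rfl | rfl | rfl) (rfl | rfl | rfl | rfl) h <;>
          first
          | rfl
          | (exfalso; simp only [← hu, ← hv, hga, hgb] at h; subst h; simp_all)
          | (exfalso; simp only [← hu, ← hv, hga, hgb] at h; simp_all)
    have mono : ∀ x y, mult A θ vt x y = 1 → ∀ f ∈ A, vt f = x → vt (θ f) = y →
        ∀ d ∈ A, vt d = x → vt (θ d) = y → d = f := by
      intro x y h f hf f1 f2 d hd d1 d2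
      unfold mult at h
      exact Finset.card_le_one.1 h.le d (by simp [hd, d1, d2]) f (by simp [hf, f1, f2])
    have none : ∀ x y, mult A θ vt x y = 0 → ∀ d ∈ A, vt d = x → vt (θ d) = y → False := by
      intro x y h d hd d1 d2
      unfold mult at h
      rw [Finset.card_eq_zero, Finset.filter_eq_empty_iff] at h
      exact h hd ⟨d1, d2⟩
    by_cases h1 : mult A θ vt u v = 1
    · refine ⟨M, fun x => decide (x = u ∨ x = v), P, Or.inl rfl, ?_⟩
      have hab1 : mult A θ vt a b = 1 := by omega
      intro d hd _ hMd
      have hn := G.no_loop hd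
      rcases hWe _ (hmem d hd) with h | h | h | h <;>
        rcases hWe _ (hmem _ (G.mem d hd)) with h' | h' | h' | h'
      all_goals first
        | exact absurd (h'.trans h.symm) hn
        | (simp [h, h', hau, hav, hbu, hbv]; done)
        | skip
      · exact absurd (Or.inl (mono _ _ h1 e he rfl rfl d hd h h')) hMd
      · exact absurd (Or.inr (Or.inl (mono v u (by rw [mult_comm G]; exact h1) (θ e)
          (G.mem _ he) rfl (by rw [G.inv _ he]) d hd h h'))) hMd
      · exact absurd (Or.inr (Or.inr (Or.inl (mono _ _ hab1 g hgA hga hgb d hd h h')))) hMd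
      · exact absurd (Or.inr (Or.inr (Or.inr (mono b a (by rw [mult_comm G]; exact hab1) (θ g)
          (G.mem _ hgA) hgb (by rw [G.inv _ hgA]; exact hga) d hd h h')))) hMd
    · by_cases h2 : mult A θ vt u a = 0
      · refine ⟨M, fun x => decide (x = u ∨ x = a), P, Or.inl rfl, ?_⟩
        have hvb : mult A θ vt v b = 0 := by omega
        intro d hd _ hMd
        have hn := G.no_loop hd
        rcases hWe _ (hmem d hd) with h | h | h | h <;>
          rcases hWe _ (hmem _ (G.mem d hd)) with h' | h' | h' | h'
        all_goals first
          | exact absurd (h'.trans h.symm) hn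
          | (simp [h, h', hau, hav.symm, hbu, huv, hab.symm]; done)
          | skip
        · exact (none _ _ h2 d hd h h').elim
        · exact (none _ _ hvb d hd h h').elim
        · exact (none a u (by rw [mult_comm G]; exact h2) d hd h h').elim
        · exact (none b v (by rw [mult_comm G]; exact hvb) d hd h h').elim
      · refine ⟨M, fun x => decide (x = u ∨ x = b), P, Or.inl rfl, ?_⟩
        have hub : mult A θ vt u b = 0 := by omega
        have hva : mult A θ vt v a = 0 := by omega
        intro d hd _ hMd
        have hn := G.no_loop hd
        rcases hWe _ (hmem d hd) with h | h | h | h <;>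
          rcases hWe _ (hmem _ (G.mem d hd)) with h' | h' | h' | h'
        all_goals first
          | exact absurd (h'.trans h.symm) hn
          | (simp [h, h', hau, hbv.symm, hbu, huv, hab]; done)
          | skip
        · exact (none _ _ hub d hd h h').elim
        · exact (none _ _ hva d hd h h').elim
        · exact (none a v (by rw [mult_comm G]; exact hva) d hd h h').elim
        · exact (none b u (by rw [mult_comm G]; exact hub) d hd h h').elim

end Base

section Solid

variable {D : Type*} {A : Finset D} {θ : D → D} {vt : D → V} {L : D → Prop}

open scoped Classical in
/-- The number of darts starting in `U`. -/
noncomputable def dartCount (A : Finset D) (vt : D → V) (U : V → Prop) : ℕ :=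
  (A.filter fun d => U (vt d)).card

/-- A cubic graph on at least six vertices without nontrivial 3-edge-cuts. -/
structure IsSolid (A : Finset D) (θ : D → D) (vt : D → V) : Prop where
  cubic : IsCubic A θ vt
  large : 18 ≤ A.card
  trivial_cut : ∀ U, cutCard A θ vt U = 3 →
    dartCount A vt U ≤ 3 ∨ dartCount A vt (fun x => ¬ U x) ≤ 3

lemma dartCount_add (U : V → Prop) :
    dartCount A vt U + dartCount A vt (fun x => ¬ U x) = A.card := by
  classical
  unfold dartCount
  have := Finset.card_filter_add_card_filter_not (s := A) (fun d => U (vt d))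
  convert this

lemma dartCount_le (G : IsCubic A θ vt) {U : V → Prop} (T : Finset V)
    (hU : ∀ x, U x → x ∈ T) : dartCount A vt U ≤ 3 * T.card := by
  classical
  unfold dartCount
  rw [Finset.card_eq_sum_card_fiberwise (f := vt) (t := T)]
  · rw [mul_comm, ← smul_eq_mul]
    refine Finset.sum_le_card_nsmul _ _ _ fun v _ => ?_
    rw [Finset.filter_filter]
    rcases Finset.eq_empty_or_nonempty (A.filter fun d => U (vt d) ∧ vt d = v) with h | ⟨d, hd⟩
    · have : (A.filter fun d => U (vt d) ∧ vt d = v).card ≤ 3 := by rw [h]; simp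
      exact le_trans (le_of_eq (by congr)) this
    · rw [Finset.mem_filter] at hd
      have h3 := G.three d hd.1
      have : (A.filter fun x => U (vt x) ∧ vt x = v).card ≤
          (A.filter fun x => vt x = vt d).card := by
        refine Finset.card_le_card fun x hx => ?_
        rw [Finset.mem_filter] at hx ⊢
        exact ⟨hx.1, hx.2.2.trans hd.2.2.symm⟩
      have h3' : (A.filter fun x => vt x = vt d).card = 3 := by convert h3
      rw [h3'] at this
      exact le_trans (le_of_eq (by congr)) this
  · intro x hx
    exact hU _ (Finset.mem_filter.1 hx).2

lemma exists_of_dartCount_pos {U : V → Prop} (h : 0 < dartCount A vt U) :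
    ∃ d ∈ A, U (vt d) := by
  classical
  obtain ⟨d, hd⟩ := Finset.card_pos.1 h
  exact ⟨d, Finset.mem_filter.1 hd⟩

lemma three_le_dartCount (G : IsCubic A θ vt) {U : V → Prop} {d : D} (hd : d ∈ A)
    (h : U (vt d)) : 3 ≤ dartCount A vt U := by
  classical
  have h3 := G.three d hd
  have h3' : (A.filter fun x => vt x = vt d).card = 3 := by convert h3
  rw [← h3']
  refine Finset.card_le_card fun x hx => ?_
  rw [Finset.mem_filter] at hx ⊢
  exact ⟨hx.1, hx.2 ▸ h⟩

lemma dartCount_sdiff (G : IsCubic A θ vt) {U : V → Prop} {d : D} (hd : d ∈ A)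
    (h : U (vt d)) : dartCount A vt (fun x => U x ∧ x ≠ vt d) + 3 = dartCount A vt U := by
  classical
  have h3 := G.three d hd
  have h3' : (A.filter fun x => vt x = vt d).card = 3 := by convert h3
  have := Finset.card_filter_add_card_filter_not (s := A.filter fun x => U (vt x))
    (fun x => vt x = vt d)
  rw [Finset.filter_filter, Finset.filter_filter] at this
  have e : (A.filter fun x => U (vt x) ∧ vt x = vt d) = A.filter fun x => vt x = vt d := by
    ext x
    simp only [Finset.mem_filter]
    constructor
    · rintro ⟨a, b, c⟩; exact ⟨a, c⟩
    · rintro ⟨a, c⟩; exact ⟨a, c ▸ h, c⟩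
  rw [e, h3'] at this
  unfold dartCount
  rw [add_comm]
  convert this

lemma six_le_dartCount (G : IsCubic A θ vt) {U : V → Prop} {d d' : D} (hd : d ∈ A)
    (hd' : d' ∈ A) (h : U (vt d)) (h' : U (vt d')) (hne : vt d ≠ vt d') :
    6 ≤ dartCount A vt U := by
  have h1 := dartCount_sdiff G hd h
  have h2 := three_le_dartCount G (U := fun x => U x ∧ x ≠ vt d) hd' ⟨h', hne.symm⟩
  omega

lemma cutCard_add_le {U : V → Prop} {I : Finset D} (hI : I ⊆ A)
    (h : ∀ d ∈ I, U (vt d) ∧ U (vt (θ d))) : cutCard A θ vt U + I.card ≤ dartCount A vt U := by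
  classical
  unfold cutCard dartCount
  rw [← Finset.card_union_of_disjoint]
  · refine Finset.card_le_card (Finset.union_subset ?_ ?_)
    · intro x hx
      rw [Finset.mem_filter] at hx ⊢
      exact ⟨hx.1, hx.2.1⟩
    · intro x hx
      rw [Finset.mem_filter]
      exact ⟨hI hx, (h x hx).1⟩
  · rw [Finset.disjoint_left]
    intro x hx hx'
    exact (Finset.mem_filter.1 hx).2.2 (h x hx').2

open scoped Classical in
lemma cutCard_sdiff (G : IsCubic A θ vt) {U : V → Prop} {d : D} (hd : d ∈ A) (h : U (vt d)) :
    cutCard A θ vt (fun x => U x ∧ x ≠ vt d) +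
      2 * (A.filter fun x => vt x = vt d ∧ ¬ U (vt (θ x))).card = cutCard A θ vt U + 3 := by
  have h3 : (A.filter fun x => vt x = vt d).card = 3 := by
    have := G.three d hd; convert this
  have e1 := Finset.card_filter_add_card_filter_not (s := A.filter fun x => vt x = vt d)
    (fun x => U (vt (θ x)))
  rw [Finset.filter_filter, Finset.filter_filter, h3] at e1
  have e2 : (A.filter fun x => vt x = vt d ∧ U (vt (θ x))).card =
      (A.filter fun x => (U (vt x) ∧ vt x ≠ vt d) ∧ vt (θ x) = vt d).card := by
    refine Finset.card_bij' (fun d _ => θ d) (fun d _ => θ d) ?_ ?_ ?_ ?_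
    · intro x hx
      rw [Finset.mem_filter] at hx ⊢
      rw [G.inv _ hx.1]
      exact ⟨G.mem _ hx.1, ⟨hx.2.2, by rw [← hx.2.1]; exact G.no_loop hx.1⟩, hx.2.1⟩
    · intro x hx
      rw [Finset.mem_filter] at hx ⊢
      rw [G.inv _ hx.1]
      exact ⟨G.mem _ hx.1, hx.2.2, hx.2.1.1⟩
    · intro x hx; exact G.inv _ (Finset.mem_filter.1 hx).1
    · intro x hx; exact G.inv _ (Finset.mem_filter.1 hx).1
  have e3 : cutCard A θ vt (fun x => U x ∧ x ≠ vt d) =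
      (A.filter fun x => (U (vt x) ∧ vt x ≠ vt d) ∧ vt (θ x) = vt d).card +
      (A.filter fun x => (U (vt x) ∧ vt x ≠ vt d) ∧ ¬ U (vt (θ x))).card := by
    unfold cutCard
    rw [← Finset.card_union_of_disjoint]
    · congr 1
      ext x
      simp only [Finset.mem_filter, Finset.mem_union]
      tauto
    · rw [Finset.disjoint_filter]
      rintro x - ⟨-, a⟩ ⟨-, b⟩
      exact b (a ▸ h)
  have e4 : cutCard A θ vt U =
      (A.filter fun x => vt x = vt d ∧ ¬ U (vt (θ x))).card +
      (A.filter fun x => (U (vt x) ∧ vt x ≠ vt d) ∧ ¬ U (vt (θ x))).card := by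
    unfold cutCard
    rw [← Finset.card_union_of_disjoint]
    · congr 1
      ext x
      simp only [Finset.mem_filter, Finset.mem_union]
      have : vt x = vt d → U (vt x) := fun e => e ▸ h
      tauto
    · rw [Finset.disjoint_filter]
      rintro x - ⟨a, -⟩ ⟨b, -⟩
      exact b.2 a
  omega

namespace IsSolid

lemma cut_ne_three (S : IsSolid A θ vt) {U : V → Prop} {d₁ d₂ d₃ d₄ : D} (h₁ : d₁ ∈ A)
    (h₂ : d₂ ∈ A) (h₃ : d₃ ∈ A) (h₄ : d₄ ∈ A) (u₁ : U (vt d₁)) (u₂ : U (vt d₂))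
    (u₃ : ¬ U (vt d₃)) (u₄ : ¬ U (vt d₄)) (h : vt d₁ ≠ vt d₂) (h' : vt d₃ ≠ vt d₄) :
    cutCard A θ vt U ≠ 3 := by
  intro hc
  have a := six_le_dartCount S.cubic h₁ h₂ u₁ u₂ h
  have b := six_le_dartCount S.cubic (U := fun x => ¬ U x) h₃ h₄ u₃ u₄ h'
  rcases S.trivial_cut U hc with h | h <;> omega

lemma cut_ge_of_large (S : IsSolid A θ vt) {U : V → Prop} {d d' : D} (hd : d ∈ A)
    (hd' : d' ∈ A) (h : U (vt d)) (h' : ¬ U (vt d')) (hU : 9 ≤ dartCount A vt U) :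
    3 ≤ cutCard A θ vt U := by
  classical
  by_contra hlt
  have hG := S.cubic
  have h1 := hG.bridgeless U
  have fin : ∀ d ∈ A, U (vt d) → cutCard A θ vt (fun x => U x ∧ x ≠ vt d) ≠ 3 := by
    intro d hd h hc
    have a := dartCount_sdiff hG hd h
    have b := six_le_dartCount hG (U := fun x => ¬ (U x ∧ x ≠ vt d)) hd hd' (by simp) (by simp [h'])
      (fun e => h' (e ▸ h))
    rcases S.trivial_cut _ hc with h | h <;> omega
  have h02 : cutCard A θ vt U = 0 ∨ cutCard A θ vt U = 2 := by omega
  rcases h02 with h0 | h2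
  · have e := cutCard_sdiff hG hd h
    have hz : (A.filter fun x => vt x = vt d ∧ ¬ U (vt (θ x))).card = 0 := by
      unfold cutCard at h0
      rw [Finset.card_eq_zero] at h0 ⊢
      rw [Finset.filter_eq_empty_iff] at h0 ⊢
      rintro x hx ⟨a, b⟩
      exact h0 hx ⟨a ▸ h, b⟩
    have := fin d hd h
    omega
  · obtain ⟨k, hk⟩ : (A.filter fun d => U (vt d) ∧ ¬ U (vt (θ d))).Nonempty := by
      rw [← Finset.card_pos]
      have : (A.filter fun d => U (vt d) ∧ ¬ U (vt (θ d))).card = 2 := by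
        rw [← h2]; unfold cutCard; congr
      omega
    rw [Finset.mem_filter] at hk
    have e := cutCard_sdiff hG hk.1 hk.2.1
    have hpos : 0 < (A.filter fun x => vt x = vt k ∧ ¬ U (vt (θ x))).card :=
      Finset.card_pos.2 ⟨k, by simp [hk.1, hk.2.2]⟩
    have a := fin k hk.1 hk.2.1
    have b := hG.bridgeless (fun x => U x ∧ x ≠ vt k)
    omega

/-- Solid graphs are 3-edge-connected. -/
lemma three_le_cut (S : IsSolid A θ vt) {U : V → Prop} {d d' : D} (hd : d ∈ A)
    (hd' : d' ∈ A) (h : U (vt d)) (h' : ¬ U (vt d')) : 3 ≤ cutCard A θ vt U := by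
  have := dartCount_add (A := A) (vt := vt) U
  have hl := S.large
  rcases Nat.lt_or_ge (dartCount A vt U) 9 with hlt | hge
  · rw [← cutCard_compl S.cubic]
    exact S.cut_ge_of_large (U := fun x => ¬ U x) hd' hd h' (fun h'' => h'' h) (by omega)
  · exact S.cut_ge_of_large hd hd' h h' hge

lemma exists_not_mem (S : IsSolid A θ vt) {T : Finset V} (hT : T.card ≤ 3) :
    9 ≤ dartCount A vt (fun x => ¬ x ∈ T) := by
  have a := dartCount_le S.cubic (U := fun x => x ∈ T) T fun _ h => h
  have b := dartCount_add (A := A) (vt := vt) (fun x => x ∈ T)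
  have c := S.large
  omega

lemma exists_dart (S : IsSolid A θ vt) {T : Finset V} (hT : T.card ≤ 3) :
    ∃ d ∈ A, ¬ vt d ∈ T := by
  classical
  have := S.exists_not_mem hT
  exact exists_of_dartCount_pos (U := fun x => ¬ x ∈ T) (by omega)

/-- Solid graphs have no parallel edges. -/
lemma no_parallel (S : IsSolid A θ vt) {d d' : D} (hd : d ∈ A) (hd' : d' ∈ A)
    (h : vt d = vt d') (h' : vt (θ d) = vt (θ d')) : d = d' := by
  classical
  by_contra hne
  have hG := S.cubic
  set T : Finset V := {vt d, vt (θ d)} with hT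
  have hcard : T.card ≤ 2 := Finset.card_le_two
  obtain ⟨x, hx, hxT⟩ := S.exists_dart (T := T) (by omega)
  have h3 := S.three_le_cut (U := fun x => x ∈ T) hd hx (by simp [hT]) hxT
  have hle := dartCount_le hG (U := fun x => x ∈ T) T fun _ h => h
  have inj : θ d ≠ θ d' := fun e => hne (by rw [← hG.inv d hd, e, hG.inv _ hd'])
  have hn := hG.no_loop hd
  have hn' : vt (θ d') ≠ vt d := fun e => hG.no_loop hd' (e.trans h)
  have hI : ({d, d', θ d, θ d'} : Finset D).card = 4 := by
    rw [Finset.card_insert_of_notMem, Finset.card_insert_of_notMem, Finset.card_pair inj]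
    · simp only [Finset.mem_insert, Finset.mem_singleton, not_or]
      exact ⟨fun e => hn (by rw [← e, h]), fun e => hn' (by rw [← e, h])⟩
    · simp only [Finset.mem_insert, Finset.mem_singleton, not_or]
      exact ⟨hne, fun e => hn (by rw [← e]), fun e => hn' (by rw [← e])⟩
  have := cutCard_add_le (A := A) (θ := θ) (vt := vt) (U := fun x => x ∈ T)
    (I := {d, d', θ d, θ d'})
    (by
      intro y hy
      simp only [Finset.mem_insert, Finset.mem_singleton] at hy
      rcases hy with rfl | rfl | rfl | rfl
      exacts [hd, hd', hG.mem _ hd, hG.mem _ hd'])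
    (by
      intro y hy
      simp only [Finset.mem_insert, Finset.mem_singleton] at hy
      rcases hy with rfl | rfl | rfl | rfl <;>
        simp [hT, hG.inv _ hd, hG.inv _ hd', ← h, ← h'])
  omega

/-- Solid graphs have no triangles. -/
lemma no_triangle (S : IsSolid A θ vt) {d₁ d₂ d₃ : D} (h₁ : d₁ ∈ A) (h₂ : d₂ ∈ A) (h₃ : d₃ ∈ A)
    (e₁ : vt (θ d₁) = vt d₂) (e₂ : vt (θ d₂) = vt d₃) (e₃ : vt (θ d₃) = vt d₁) : False := by
  classical
  have hG := S.cubic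
  have n1 : vt d₂ ≠ vt d₁ := e₁ ▸ hG.no_loop h₁
  have n2 : vt d₃ ≠ vt d₂ := e₂ ▸ hG.no_loop h₂
  have n3 : vt d₁ ≠ vt d₃ := e₃ ▸ hG.no_loop h₃
  set T : Finset V := {vt d₁, vt d₂, vt d₃} with hT
  have hcard : T.card ≤ 3 := Finset.card_le_three
  obtain ⟨x, hx, hxT⟩ := S.exists_dart hcard
  have h3 := S.three_le_cut (U := fun x => x ∈ T) h₁ hx (by simp [hT]) hxT
  have hle := dartCount_le hG (U := fun x => x ∈ T) T fun _ h => h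
  have hne : ∀ x y, vt x ≠ vt y → x ≠ y := fun x y h e => h (e ▸ rfl)
  have hI : ({d₁, d₂, d₃, θ d₁, θ d₂, θ d₃} : Finset D).card = 6 := by
    have hne' : ∀ x, ∀ y ∈ A, vt (θ x) ≠ vt y → x ≠ θ y := fun x y hy h e =>
      h (by rw [e, hG.inv _ hy])
    rw [Finset.card_insert_of_notMem, Finset.card_insert_of_notMem, Finset.card_insert_of_notMem,
      Finset.card_insert_of_notMem, Finset.card_pair]
    · exact hne _ _ (by rw [e₂, e₃]; exact n3.symm)
    · simp only [Finset.mem_insert, Finset.mem_singleton, not_or]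
      exact ⟨hne _ _ (by rw [e₁, e₂]; exact n2.symm), hne _ _ (by rw [e₁, e₃]; exact n1)⟩
    · simp only [Finset.mem_insert, Finset.mem_singleton, not_or]
      exact ⟨hne _ _ (by rw [e₁]; exact n2), hne' _ _ h₂ (by rw [e₃]; exact n1.symm),
        (hG.ne _ h₃).symm⟩
    · simp only [Finset.mem_insert, Finset.mem_singleton, not_or]
      exact ⟨hne _ _ n2.symm, hne' _ _ h₁ (by rw [e₂]; exact n3.symm), (hG.ne _ h₂).symm,
        hne _ _ (by rw [e₃]; exact n1)⟩
    · simp only [Finset.mem_insert, Finset.mem_singleton, not_or]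
      exact ⟨hne _ _ n1.symm, hne _ _ n3, (hG.ne _ h₁).symm, hne _ _ (by rw [e₂]; exact n3),
        hne' _ _ h₃ (by rw [e₁]; exact n2.symm)⟩
  have := cutCard_add_le (A := A) (θ := θ) (vt := vt) (U := fun x => x ∈ T)
    (I := {d₁, d₂, d₃, θ d₁, θ d₂, θ d₃})
    (by
      intro y hy
      simp only [Finset.mem_insert, Finset.mem_singleton] at hy
      rcases hy with rfl | rfl | rfl | rfl | rfl | rfl
      exacts [h₁, h₂, h₃, hG.mem _ h₁, hG.mem _ h₂, hG.mem _ h₃])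
    (by
      intro y hy
      simp only [Finset.mem_insert, Finset.mem_singleton] at hy
      rcases hy with rfl | rfl | rfl | rfl | rfl | rfl <;>
        simp [hT, hG.inv _ h₁, hG.inv _ h₂, hG.inv _ h₃, e₁, e₂, e₃])
  have hT3 : dartCount A vt (fun x => x ∈ T) = 9 := by omega
  have hout := S.exists_not_mem hcard
  rcases S.trivial_cut (fun x => x ∈ T) (by omega) with h | h <;> omega

end IsSolid

end Solid

section DoubleSplice

variable {D : Type*} {A : Finset D} {θ : D → D} {vt : D → V} {L : D → Prop}
variable {a₀ a₁ a₂ p₀ p₁ p₂ b₀ b₁ b₂ g₀ g₁ g₂ : D}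

namespace IsSolid

lemma splice (S : IsSolid A θ vt) (Fa : IsFiber A vt a₀ a₁ a₂) (Fp : IsFiber A vt p₀ p₁ p₂)
    (link : θ a₁ = p₀) : Splice A θ vt a₀ a₁ a₂ p₀ p₁ p₂ := by
  have G := S.cubic
  have hl : θ p₀ = a₁ := by rw [← link, G.inv _ Fa.my]
  refine ⟨Fa, Fp, link, ?_, G.no_loop Fa.mx, fun h => ?_, ?_, fun h => ?_, fun h => ?_, ?_,
    fun h => ?_, ?_⟩
  · rw [← link, ← Fa.vy]; exact G.no_loop Fa.my
  · exact Fa.xy (S.no_parallel Fa.mx Fa.my Fa.vy.symm (by rw [h, link]))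
  · rw [← Fa.vz]; exact G.no_loop Fa.mz
  · exact Fa.yz (S.no_parallel Fa.my Fa.mz (by rw [Fa.vy, Fa.vz]) (by rw [h, link]))
  · exact Fp.xy (S.no_parallel Fp.mx Fp.my Fp.vy.symm (by rw [hl, h, Fa.vy]))
  · rw [← Fp.vy]; exact G.no_loop Fp.my
  · exact Fp.xz (S.no_parallel Fp.mx Fp.mz Fp.vz.symm (by rw [hl, h, Fa.vy]))
  · rw [← Fp.vz]; exact G.no_loop Fp.mz

lemma splice_isCubic (S : IsSolid A θ vt) (T : Splice A θ vt a₀ a₁ a₂ p₀ p₁ p₂) :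
    IsCubic (spliceDarts A vt (vt a₀) (vt p₀)) (spliceInv θ a₀ a₂ p₁ p₂) vt := by
  have G := S.cubic
  have hl : θ p₀ = a₁ := by rw [← T.link, G.inv _ T.fa.my]
  refine T.isCubic G (fun U ha hp _ _ hz ht => ?_) (fun U ha hp hx hy _ _ => ?_)
  · refine S.cut_ne_three T.fa.mx T.fp.mx (G.mem _ T.fa.mz) (G.mem _ T.fp.mz) ha hp hz ht
      T.ap.symm fun h => ?_
    refine S.no_triangle T.fa.my T.fp.mz (G.mem _ T.fa.mz) ?_ h.symm ?_
    · rw [T.link, T.fp.vz]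
    · rw [G.inv _ T.fa.mz, T.fa.vz, T.fa.vy]
  · refine S.cut_ne_three T.fa.mx T.fp.mx (G.mem _ T.fa.mx) (G.mem _ T.fp.my) ha hp hx hy
      T.ap.symm fun h => ?_
    refine S.no_triangle T.fa.my T.fp.my (G.mem _ T.fa.mx) ?_ h.symm ?_
    · rw [T.link, T.fp.vy]
    · rw [G.inv _ T.fa.mx, T.fa.vy]

/-- In a solid graph, a second splice next to the first one is possible. -/
lemma splice_splice_isCubic (S : IsSolid A θ vt) (T : Splice A θ vt a₀ a₁ a₂ p₀ p₁ p₂)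
    (T' : Splice (spliceDarts A vt (vt a₀) (vt p₀)) (spliceInv θ a₀ a₂ p₁ p₂) vt b₀ b₁ b₂ g₀ g₁ g₂)
    (hb : b₀ = θ p₁) (hqb : vt (θ a₂) ≠ vt b₀) (hqg : vt (θ a₂) ≠ vt g₀)
    (hrb : vt (θ p₂) ≠ vt b₀) (hrg : vt (θ p₂) ≠ vt g₀)
    (hxy : vt (θ a₀) ≠ vt (spliceInv θ a₀ a₂ p₁ p₂ g₁))
    (hzt : vt (spliceInv θ a₀ a₂ p₁ p₂ b₂) ≠ vt (spliceInv θ a₀ a₂ p₁ p₂ g₂)) :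
    IsCubic (spliceDarts (spliceDarts A vt (vt a₀) (vt p₀)) vt (vt b₀) (vt g₀))
      (spliceInv (spliceInv θ a₀ a₂ p₁ p₂) b₀ b₂ g₁ g₂) vt := by
  have G := S.cubic
  have G' := S.splice_isCubic T
  set φ := spliceInv θ a₀ a₂ p₁ p₂ with hφ
  have hx : φ b₀ = θ a₀ := by rw [hb, hφ, Splice.inv_y G T]
  have my := mem_spliceDarts.1 (mem_spliceDarts.1 (T'.mem_y G')).1
  have mz := mem_spliceDarts.1 (mem_spliceDarts.1 (T'.mem_z G')).1
  have mt := mem_spliceDarts.1 (mem_spliceDarts.1 (T'.mem_t G')).1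
  have xb := T'.xa
  have xg := T'.xp
  rw [hx] at xb xg
  have yb : vt (θ p₁) = vt b₀ := by rw [hb]
  refine T'.isCubic G' (fun U ub ug ux uy uz ut hc => ?_) (fun U ub ug ux uy uz ut hc => ?_)
  all_goals
    rw [hx] at ux
    have hU : assign U (vt b₀) (vt g₀) True True = U := by
      have := assign_self (U := U) (a := vt b₀) (p := vt g₀)
      simpa only [ub, ug] using this
    obtain ⟨N2, -, e2⟩ := T'.cut_formula G' U
    have eT := e2 True True
    have eF := e2 False False
    rw [hU, hc] at eT
    rw [hx] at eT eF
    obtain ⟨N1, f1, f1'⟩ := T.cut_formula G U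
    obtain ⟨N0, f0, f0'⟩ := T.cut_formula G (assign U (vt b₀) (vt g₀) False False)
    rw [← hφ, hc, yb] at f1
    rw [← hφ, eF, yb, assign_left, assign_off xb xg, assign_off hqb hqg, assign_off hrb hrg] at f0
    simp only [yb] at f1'
    simp only [yb, assign_left, assign_off xb xg, assign_off hqb hqg, assign_off hrb hrg] at f0'
  · have h1 : cutCard A θ vt (assign U (vt a₀) (vt p₀) True True) ≠ 3 := by
      refine S.cut_ne_three T.fa.mx T.fp.mx mz.1 mt.1 ?_ ?_ ?_ ?_ T.ap.symm hzt
      · rw [assign_left]; trivial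
      · rw [assign_right T.ap]; trivial
      · rw [assign_off mz.2.1 mz.2.2]; exact uz
      · rw [assign_off mt.2.1 mt.2.2]; exact ut
    have h2 : cutCard A θ vt (assign (assign U (vt b₀) (vt g₀) False False)
        (vt a₀) (vt p₀) False False) ≠ 3 := by
      refine S.cut_ne_three (G.mem _ T.fa.mx) my.1 T.fa.mx T.fp.mx ?_ ?_ ?_ ?_ hxy T.ap.symm
      · rw [assign_off T.xa T.xp, assign_off xb xg]; exact ux
      · rw [assign_off my.2.1 my.2.2, assign_off T'.ya T'.yp]; exact uy
      · rw [assign_left]; tauto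
      · rw [assign_right T.ap]; tauto
    have h3 : 3 ≤ cutCard A θ vt (assign (assign U (vt b₀) (vt g₀) False False)
        (vt a₀) (vt p₀) True False) := by
      refine S.three_le_cut T.fa.mx T.fp.mx ?_ ?_
      · rw [assign_left]; trivial
      · rw [assign_right T.ap]; tauto
    rw [f1'] at h1
    rw [f0'] at h2 h3
    by_cases c1 : U (vt (θ a₂)) <;> by_cases c2 : U (vt (θ p₂)) <;>
      simp [c1, c2, ux, uy, uz, ut, ub, diffCount] at eT eF f1 f0 h1 h2 h3 <;> omega
  · have h1 : cutCard A θ vt (assign U (vt a₀) (vt p₀) True True) ≠ 3 := by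
      refine S.cut_ne_three T.fa.mx T.fp.mx (G.mem _ T.fa.mx) my.1 ?_ ?_ ?_ ?_ T.ap.symm hxy
      · rw [assign_left]; trivial
      · rw [assign_right T.ap]; trivial
      · rw [assign_off T.xa T.xp]; exact ux
      · rw [assign_off my.2.1 my.2.2]; exact uy
    have h2 : cutCard A θ vt (assign (assign U (vt b₀) (vt g₀) False False)
        (vt a₀) (vt p₀) False False) ≠ 3 := by
      refine S.cut_ne_three mz.1 mt.1 T.fa.mx T.fp.mx ?_ ?_ ?_ ?_ hzt T.ap.symm
      · rw [assign_off mz.2.1 mz.2.2, assign_off T'.za T'.zp]; exact uz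
      · rw [assign_off mt.2.1 mt.2.2, assign_off T'.ta T'.tp]; exact ut
      · rw [assign_left]; tauto
      · rw [assign_right T.ap]; tauto
    have h3 : 3 ≤ cutCard A θ vt (assign U (vt a₀) (vt p₀) False True) := by
      refine S.three_le_cut T.fp.mx T.fa.mx ?_ ?_
      · rw [assign_right T.ap]; trivial
      · rw [assign_left]; tauto
    rw [f1'] at h1 h3
    rw [f0'] at h2
    by_cases c1 : U (vt (θ a₂)) <;> by_cases c2 : U (vt (θ p₂)) <;>
      simp [c1, c2, ux, uy, uz, ut, ub, diffCount] at eT eF f1 f0 h1 h2 h3 <;> omega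

end IsSolid

lemma Quellable.symm (G : IsCubic A θ vt) {e : D} (he : e ∈ A)
    (h : Quellable A θ vt L (θ e)) : Quellable A θ vt L e := by
  obtain ⟨M, c, P, h, C⟩ := h
  exact ⟨M, c, P, by simpa [G.inv e he] using P.symm _ h, C⟩

/-- Lifting a quelling matching through a splice. -/
lemma Splice.lift_quellable (G : IsCubic A θ vt) (T : Splice A θ vt a₀ a₁ a₂ p₀ p₁ p₂)
    {e : D} (he : e ≠ θ a₀) (hv : vt e = vt (θ a₀)) {M' : D → Prop}
    (P : IsPM (spliceDarts A vt (vt a₀) (vt p₀)) (spliceInv θ a₀ a₂ p₁ p₂) vt M') (hM' : M' e) :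
    ∃ M, IsPM A θ vt M ∧ (∀ d, M' d → M d) ∧
      (M' (θ a₂) ∧ M a₂ ∧ M p₂ ∨ ¬ M' (θ a₂) ∧ M a₁ ∧ M p₀) :=
  T.lift G P fun h => he (P.uniq _ _ hM' h hv)

lemma IsEven.two_of_not (E : IsEven A θ vt L) {x y z : D} (F : IsFiber A vt x y z) (hx : ¬ L x)
    (h : ∃ w ∈ A, vt w = vt x ∧ L w) : L y ∧ L z := by
  have := E.iff F
  obtain ⟨w, hw, e, hL⟩ := h
  rcases F.all w hw e with rfl | rfl | rfl <;> tauto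

lemma IsEven.exists_fiber (G : IsCubic A θ vt) (E : IsEven A θ vt L) {d : D} (hd : d ∈ A)
    (hL : L d) : ∃ x y, IsFiber A vt d x y ∧ L x ∧ ¬ L y := by
  obtain ⟨x, y, F⟩ := G.fiber hd
  have := E.iff F
  by_cases hx : L x
  · exact ⟨x, y, F, hx, by tauto⟩
  · exact ⟨y, x, F.swap, by tauto, hx⟩

lemma Comp.exists_dart (G : IsCubic A θ vt) (E : IsEven A θ vt L) {v x : V}
    (h : Comp A θ vt L v x) (hv : ∃ d ∈ A, vt d = v ∧ L d) : ∃ d ∈ A, vt d = x ∧ L d :=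
  h (fun x => ∃ d ∈ A, vt d = x ∧ L d)
    (fun d hd hL _ => ⟨θ d, G.mem d hd, rfl, E.symm d hd hL⟩) hv

/-- The case of a splice with a neighbour of the root edge that meets `L`. -/
lemma IsSolid.quellable_of_dart (S : IsSolid A θ vt) (E : IsEven A θ vt L)
    (IH : ∀ (A' : Finset D) (θ' : D → D) (L' : D → Prop) (e' : D), A'.card < A.card →
      IsCubic A' θ' vt → IsEven A' θ' vt L' → e' ∈ A' → Quellable A' θ' vt L' e')
    {e h : D} (he : e ∈ A) (hh : h ∈ A) (hne : e ≠ h) (hv : vt e = vt h)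
    (hL : ∃ x ∈ A, vt x = vt (θ h) ∧ L x) : Quellable A θ vt L e := by
  have G := S.cubic
  have hθ : θ (θ h) = h := G.inv h hh
  obtain ⟨a₁, a₂, p₁, p₂, T, hcase⟩ : ∃ a₁ a₂ p₁ p₂, Splice A θ vt (θ h) a₁ a₂ (θ a₁) p₁ p₂ ∧
      ((L (θ h) ∧ L a₁ ∧ ¬ L a₂ ∧ L p₁ ∧ ¬ L p₂) ∨
        (¬ L (θ h) ∧ L a₁ ∧ L a₂ ∧ ¬ L p₁ ∧ L p₂)) := by
    by_cases h0 : L (θ h)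
    · obtain ⟨x, y, F, hx, hy⟩ := E.exists_fiber G (G.mem h hh) h0
      obtain ⟨x', y', F', hx', hy'⟩ := E.exists_fiber G (G.mem _ F.my) (E.symm _ F.my hx)
      exact ⟨x, y, x', y', S.splice F F' rfl, Or.inl ⟨h0, hx, hy, hx', hy'⟩⟩
    · obtain ⟨x, y, F⟩ := G.fiber (G.mem h hh)
      obtain ⟨hx, hy⟩ := E.two_of_not F h0 hL
      obtain ⟨x', y', F', hx', hy'⟩ := E.exists_fiber G (G.mem _ F.my) (E.symm _ F.my hx)
      exact ⟨x, y, y', x', S.splice F F'.swap rfl, Or.inr ⟨h0, hx, hy, hy', hx'⟩⟩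
  have hmem : e ∈ spliceDarts A vt (vt (θ h)) (vt (θ a₁)) := by
    refine mem_spliceDarts.2 ⟨he, ?_, ?_⟩
    · have := T.xa; rwa [hθ, ← hv] at this
    · have := T.xp; rwa [hθ, ← hv] at this
  obtain ⟨M', c, P', hM', C⟩ := IH _ _ L e T.card_lt (S.splice_isCubic T)
    (T.isEven G E (by tauto) (by tauto)) hmem
  obtain ⟨M, P, hsub, hdisj⟩ := T.lift_quellable G (by rwa [hθ]) (by rwa [hθ]) P' hM'
  have hMh : ¬ M' h := fun h' => hne (P'.uniq _ _ hM' h' hv)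
  have C0 : L (θ h) → c (vt h) ≠ c (vt (θ p₁)) := fun h0 => by
    have := C (θ (θ h)) (T.mem_x G) (E.symm _ (G.mem h hh) h0) (by rwa [hθ])
    rwa [Splice.inv_x, hθ] at this
  have C2 : L a₂ → ¬ M' (θ a₂) → c (vt (θ a₂)) ≠ c (vt (θ p₂)) := fun h2 hM2 => by
    have := C (θ a₂) (T.mem_z G) (E.symm _ T.fa.mz h2) hM2
    rwa [Splice.inv_z G T] at this
  have finish : ∀ α β : Bool, _ → _ → _ → _ → _ → Quellable A θ vt L e :=
    fun α β k0 k1 k2 k3 k4 => by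
      obtain ⟨c', hc'⟩ := T.lift_colouring G P E.symm
        (fun d hd hLd hMd => C d hd hLd fun h' => hMd (hsub d h')) (α := α) (β := β) k0 k1 k2 k3 k4
      exact ⟨M, c', P, hsub e hM', hc'⟩
  rcases hcase with ⟨l0, l1, l2, l3, l4⟩ | ⟨l0, l1, l2, l3, l4⟩
  · refine finish (!c (vt h)) (c (vt h)) ?_ ?_ ?_ ?_ ?_
    · intro _ _; rw [hθ]; simp
    · intro _ _; simp
    · intro h'; exact absurd h' l2
    · intro _ _; exact C0 l0
    · intro h'; exact absurd h' l4
  · refine finish (!c (vt (θ a₂))) (c (vt (θ a₂))) ?_ ?_ ?_ ?_ ?_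
    · intro h'; exact absurd h' l0
    · intro _ _; simp
    · intro _ _; simp
    · intro h'; exact absurd h' l3
    · intro _ hMp
      refine C2 l2 ?_
      rcases hdisj with ⟨-, -, h'⟩ | ⟨h', -⟩
      · exact absurd h' hMp
      · exact h'

end DoubleSplice

section Quellable

variable {D : Type*} {A : Finset D} {θ : D → D} {vt : D → V} {L : D → Prop}
variable {a₀ a₁ a₂ p₀ p₁ p₂ : D}

lemma IsFiber.splice {x y z : D} {a p : V} (F : IsFiber A vt x y z) (ha : vt x ≠ a)
    (hp : vt x ≠ p) : IsFiber (spliceDarts A vt a p) vt x y z :=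
  ⟨mem_spliceDarts.2 ⟨F.mx, ha, hp⟩, mem_spliceDarts.2 ⟨F.my, F.vy ▸ ha, F.vy ▸ hp⟩,
    mem_spliceDarts.2 ⟨F.mz, F.vz ▸ ha, F.vz ▸ hp⟩, F.xy, F.xz, F.yz, F.vy, F.vz,
    fun w hw => F.all w (mem_spliceDarts.1 hw).1⟩

lemma Splice.lift_colouring_of_not (G : IsCubic A θ vt) (S : Splice A θ vt a₀ a₁ a₂ p₀ p₁ p₂)
    {M M' : D → Prop} (hM : IsPM A θ vt M) {c : V → Bool} (hL : ∀ d ∈ A, L d → L (θ d))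
    (hsub : ∀ d, M' d → M d)
    (C : ∀ d ∈ spliceDarts A vt (vt a₀) (vt p₀), L d → ¬ M' d →
      c (vt d) ≠ c (vt (spliceInv θ a₀ a₂ p₁ p₂ d)))
    (ha : ∀ d, vt d = vt a₀ → ¬ L d) (hp : ∀ d, vt d = vt p₀ → ¬ L d) :
    ∃ c' : V → Bool, ∀ d ∈ A, L d → ¬ M d → c' (vt d) ≠ c' (vt (θ d)) :=
  S.lift_colouring G hM hL (fun d hd hLd hMd => C d hd hLd fun h' => hMd (hsub d h'))
    (α := true) (β := true) (fun h => absurd h (ha _ rfl)) (fun h => absurd h (ha _ S.fa.vy))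
    (fun h => absurd h (ha _ S.fa.vz)) (fun h => absurd h (hp _ S.fp.vy))
    (fun h => absurd h (hp _ S.fp.vz))

/-- The case of a splice far away from `L`. -/
lemma IsSolid.quellable_of_not (S : IsSolid A θ vt) (E : IsEven A θ vt L) (hLA : ∀ d, L d → d ∈ A)
    (IH : ∀ (A' : Finset D) (θ' : D → D) (L' : D → Prop) (e' : D), A'.card < A.card →
      IsCubic A' θ' vt → IsEven A' θ' vt L' → e' ∈ A' → Quellable A' θ' vt L' e')
    {e h : D} (he : e ∈ A) (hh : h ∈ A) (hne : e ≠ h) (hv : vt e = vt h)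
    (hu : ∀ w ∈ A, vt w = vt e → ¬ L w)
    (hn : ∀ x ∈ A, vt x = vt e → ∀ w ∈ A, vt w = vt (θ x) → ¬ L w) : Quellable A θ vt L e := by
  have G := S.cubic
  have hθ : θ (θ h) = h := G.inv h hh
  have ha : ∀ d, vt d = vt (θ h) → ¬ L d := fun d hd hL => hn h hh hv.symm d (hLA d hL) hd hL
  obtain ⟨a₁, a₂, F⟩ := G.fiber (G.mem h hh)
  obtain ⟨p₁, p₂, Fp⟩ := G.fiber (G.mem _ F.my)
  have T := S.splice F Fp rfl
  have hmem : e ∈ spliceDarts A vt (vt (θ h)) (vt (θ a₁)) := by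
    refine mem_spliceDarts.2 ⟨he, ?_, ?_⟩
    · have := T.xa; rwa [hθ, ← hv] at this
    · have := T.xp; rwa [hθ, ← hv] at this
  have hp0 : ¬ L (θ a₁) := fun h' => ha _ F.vy ((E.mem_iff G F.my).1 h')
  have hp := (E.iff Fp).not.1 hp0
  have G₁ := S.splice_isCubic T
  by_cases hp1 : L p₁
  swap
  · have hp2 : ¬ L p₂ := by tauto
    have hpL : ∀ d, vt d = vt (θ a₁) → ¬ L d := fun d hd hL => by
      rcases Fp.all d (hLA d hL) hd with rfl | rfl | rfl <;> contradiction
    obtain ⟨M', c, P', hM', C⟩ := IH _ _ L e T.card_lt G₁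
      (T.isEven G E (iff_of_false (ha _ rfl) hp1) (iff_of_false (ha _ F.vz) hp2)) hmem
    obtain ⟨M, P, hsub, -⟩ := T.lift_quellable G (by rwa [hθ]) (by rwa [hθ]) P' hM'
    obtain ⟨c', hc'⟩ := T.lift_colouring_of_not G P E.symm hsub C ha hpL
    exact ⟨M, c', P, hsub e hM', hc'⟩
  have hp2 : L p₂ := by tauto
  have E₁ := E.diff_comp G (vt (θ a₁))
  have hC1 : Comp A θ vt L (vt (θ a₁)) (vt p₁) := Fp.vy ▸ Comp.refl
  have hC2 : Comp A θ vt L (vt (θ a₁)) (vt p₂) := Fp.vz ▸ Comp.refl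
  have ha' : ∀ d, vt d = vt (θ h) → ¬ (L d ∧ ¬ Comp A θ vt L (vt (θ a₁)) (vt d)) :=
    fun d hd h' => ha d hd h'.1
  have hp' : ∀ d, vt d = vt (θ a₁) → ¬ (L d ∧ ¬ Comp A θ vt L (vt (θ a₁)) (vt d)) :=
    fun d hd h' => h'.2 (hd ▸ Comp.refl)
  have E₁' := T.isEven G E₁ (iff_of_false (ha' _ rfl) (hp' _ Fp.vy))
    (iff_of_false (ha' _ F.vz) (hp' _ Fp.vz))
  have hx : ∃ d ∈ A, vt d = vt (θ a₁) ∧ L d := ⟨p₁, Fp.my, Fp.vy, hp1⟩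
  by_cases hq : Comp A θ vt L (vt (θ a₁)) (vt (θ a₂))
  · obtain ⟨M', c, P', hM', C⟩ := IH _ _ _ e T.card_lt G₁ E₁' hmem
    obtain ⟨M, P, hsub, hdisj⟩ := T.lift_quellable G (by rwa [hθ]) (by rwa [hθ]) P' hM'
    have hc := T.lift_colouring_of_not G P E₁.symm hsub C ha' hp'
    rcases hdisj with ⟨-, -, h2⟩ | ⟨h2, -, -⟩
    · exact .of_diff_comp G E P (hsub e hM') hp2 hC2 h2 hc
    · obtain ⟨x, hx', hxv⟩ := P'.ex _ (T.mem_z G)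
      obtain ⟨y, z, Fq⟩ := G.fiber (G.mem _ F.mz)
      obtain ⟨hy, hz⟩ := E.two_of_not Fq (fun h' => ha _ F.vz ((E.mem_iff G F.mz).1 h'))
        (hq.exists_dart G E hx)
      refine .of_diff_comp G E P (hsub e hM') (d₀ := x) ?_ (hxv ▸ hq) (hsub x hx') hc
      rcases Fq.all x (mem_spliceDarts.1 (P'.sub x hx')).1 hxv with rfl | rfl | rfl
      · exact absurd hx' h2
      · exact hy
      · exact hz
  obtain ⟨b₁, b₂, Fb, hb1, hb2⟩ := E.exists_fiber G (G.mem _ Fp.my) (E.symm _ Fp.my hp1)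
  have hg0 := E.symm _ Fb.my hb1
  obtain ⟨g₂, g₁, Fg, hg2, hg1⟩ := E.exists_fiber G (G.mem _ Fb.my) hg0
  replace Fg := Fg.swap
  have T₀ := S.splice Fb Fg rfl
  have hb0 := E.symm _ Fp.my hp1
  have hCb : Comp A θ vt L (vt (θ a₁)) (vt (θ p₁)) := hC1.step Fp.my hp1
  have hCg : Comp A θ vt L (vt (θ a₁)) (vt (θ b₁)) := Comp.step Fb.my hb1 (Fb.vy ▸ hCb)
  have hub : vt e ≠ vt (θ p₁) := fun h' => hu _ Fb.mx h'.symm hb0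
  have hug : vt e ≠ vt (θ b₁) := fun h' => hu _ Fg.mx h'.symm hg0
  have hqb : vt (θ a₂) ≠ vt (θ p₁) := fun h' => hq (h' ▸ hCb)
  have hqg : vt (θ a₂) ≠ vt (θ b₁) := fun h' => hq (h' ▸ hCg)
  have hrb : vt (θ p₂) ≠ vt (θ p₁) := fun h' =>
    Fp.yz (S.no_parallel Fp.my Fp.mz (Fp.vy.trans Fp.vz.symm) h'.symm)
  have hrg : vt (θ p₂) ≠ vt (θ b₁) := fun h' =>
    S.no_triangle Fp.my Fb.my (G.mem _ Fp.mz) Fb.vy.symm h'.symm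
      (by rw [G.inv _ Fp.mz, Fp.vz, Fp.vy])
  have off : ∀ d, vt d = vt (θ p₁) ∧ d ≠ θ p₁ ∨ vt d = vt (θ b₁) →
      spliceInv θ (θ h) a₂ p₁ p₂ d = θ d := by
    intro d hd
    refine Splice.inv_off ?_ ?_ ?_ ?_
    · rintro rfl
      rw [hθ, ← hv] at hd
      tauto
    · rintro rfl
      exact hd.elim (fun h' => h'.2 rfl) fun h' => T₀.ap h'.symm
    · rintro rfl; tauto
    · rintro rfl; tauto
  have o1 := off b₁ (.inl ⟨Fb.vy, Fb.xy.symm⟩)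
  have o2 := off b₂ (.inl ⟨Fb.vz, Fb.xz.symm⟩)
  have o3 := off g₁ (.inr Fg.vy)
  have o4 := off g₂ (.inr Fg.vz)
  have oh : spliceInv θ (θ h) a₂ p₁ p₂ (θ p₁) = h := by rw [Splice.inv_y G T, hθ]
  have hbp : vt (θ b₁) ≠ vt (θ a₁) := fun h' => by
    have := S.no_parallel Fp.my (G.mem _ Fb.my) (Fp.vy.trans h'.symm)
      (by rw [G.inv _ Fb.my, Fb.vy])
    exact Fb.xy (by rw [this, G.inv _ Fb.my])
  have T' : Splice (spliceDarts A vt (vt (θ h)) (vt (θ a₁))) (spliceInv θ (θ h) a₂ p₁ p₂) vt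
      (θ p₁) b₁ b₂ (θ b₁) g₁ g₂ := by
    refine ⟨Fb.splice T.ya T.yp, Fg.splice (fun h' => ha _ h' hg0) hbp, o1, T₀.ap, ?_, ?_, ?_, ?_,
      ?_, ?_, ?_, ?_⟩
    · rwa [oh, ← hv]
    · rwa [oh, ← hv]
    · rw [o2]; exact T₀.za
    · rw [o2]; exact T₀.zp
    · rw [o3]; exact T₀.ya
    · rw [o3]; exact T₀.yp
    · rw [o4]; exact T₀.ta
    · rw [o4]; exact T₀.tp
  have G₂ := S.splice_splice_isCubic T T' rfl hqb hqg hrb hrg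
    (by
      rw [o3, hθ, ← hv]
      intro h'
      refine hn _ (G.mem _ Fg.my) h'.symm _ Fg.mx ?_ hg0
      rw [G.inv _ Fg.my, Fg.vy])
    (by
      rw [o2, o4]
      intro h'
      refine S.no_triangle Fb.my Fg.mz (G.mem _ Fb.mz) Fg.vz.symm h'.symm ?_
      rw [G.inv _ Fb.mz, Fb.vz, Fb.vy])
  have hb' : ∀ d, vt d = vt (θ p₁) → ¬ (L d ∧ ¬ Comp A θ vt L (vt (θ a₁)) (vt d)) :=
    fun d hd h' => h'.2 (hd ▸ hCb)
  have hg' : ∀ d, vt d = vt (θ b₁) → ¬ (L d ∧ ¬ Comp A θ vt L (vt (θ a₁)) (vt d)) :=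
    fun d hd h' => h'.2 (hd ▸ hCg)
  obtain ⟨M'', c, P'', hM'', C⟩ := IH _ _ _ e (T'.card_lt.trans T.card_lt) G₂
    (T'.isEven G₁ E₁' (iff_of_false (hb' _ rfl) (hg' _ Fg.vy))
      (iff_of_false (hb' _ Fb.vz) (hg' _ Fg.vz)))
    (mem_spliceDarts.2 ⟨hmem, hub, hug⟩)
  obtain ⟨M', P', hsub', hdisj⟩ := T'.lift_quellable G₁ (by rwa [oh]) (by rwa [oh]) P'' hM''
  obtain ⟨M, P, hsub, -⟩ := T.lift_quellable G (by rwa [hθ]) (by rwa [hθ]) P' (hsub' e hM'')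
  obtain ⟨c', C'⟩ := T'.lift_colouring_of_not G₁ P' E₁'.symm hsub' C hb' hg'
  have hc := T.lift_colouring_of_not G P E₁.symm hsub C' ha' hp'
  have heM := hsub e (hsub' e hM'')
  rcases hdisj with ⟨-, -, h2⟩ | ⟨-, h1, -⟩
  · exact .of_diff_comp G E P heM hg2 (Fg.vz ▸ hCg) (hsub _ h2) hc
  · exact .of_diff_comp G E P heM hb1 (Fb.vy ▸ hCb) (hsub _ h1) hc

lemma IsSolid.quellable (S : IsSolid A θ vt) (E : IsEven A θ vt L) (hLA : ∀ d, L d → d ∈ A)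
    (IH : ∀ (A' : Finset D) (θ' : D → D) (L' : D → Prop) (e' : D), A'.card < A.card →
      IsCubic A' θ' vt → IsEven A' θ' vt L' → e' ∈ A' → Quellable A' θ' vt L' e')
    {e : D} (he : e ∈ A) : Quellable A θ vt L e := by
  have G := S.cubic
  by_cases h1 : ∀ h ∈ A, vt h = vt e → h ≠ e → ∀ x ∈ A, vt x = vt (θ h) → ¬ L x
  swap
  · push Not at h1
    obtain ⟨h, hh, hv, hne, x, hx, hxv, hL⟩ := h1
    exact S.quellable_of_dart E IH he hh hne.symm hv.symm ⟨x, hx, hxv, hL⟩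
  by_cases h2 : ∀ h ∈ A, vt h = vt (θ e) → h ≠ θ e → ∀ x ∈ A, vt x = vt (θ h) → ¬ L x
  swap
  · push Not at h2
    obtain ⟨h, hh, hv, hne, x, hx, hxv, hL⟩ := h2
    exact .symm G he (S.quellable_of_dart E IH (G.mem e he) hh hne.symm hv.symm ⟨x, hx, hxv, hL⟩)
  have key : ∀ f ∈ A, (∀ h ∈ A, vt h = vt f → h ≠ f → ∀ x ∈ A, vt x = vt (θ h) → ¬ L x) →
      ∀ w ∈ A, vt w = vt f → ¬ L w := by
    intro f hf h w hw hv hL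
    obtain ⟨x, y, F⟩ := G.fiber hf
    have hx : ¬ L x := fun h' =>
      h x F.my F.vy F.xy.symm _ (G.mem _ F.my) rfl (E.symm _ F.my h')
    have hy : ¬ L y := fun h' =>
      h y F.mz F.vz F.xz.symm _ (G.mem _ F.mz) rfl (E.symm _ F.mz h')
    have := E.iff F
    rcases F.all w hw hv with rfl | rfl | rfl <;> tauto
  obtain ⟨x, y, F⟩ := G.fiber he
  refine S.quellable_of_not E hLA IH he F.my F.xy F.vy.symm (key e he h1)
    fun z hz hzv w hw hwv => ?_
  by_cases hze : z = e
  · subst hze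
    exact key _ (G.mem _ he) h2 w hw hwv
  · exact h1 z hz hzv hze w hw hwv

/-- In a bridgeless cubic multigraph, every edge lies in a perfect matching whose removal destroys
all odd cycles of a given even edge set. -/
theorem IsCubic.quellable (G : IsCubic A θ vt) (E : IsEven A θ vt L) {e : D} (he : e ∈ A) :
    Quellable A θ vt L e := by
  classical
  induction hn : A.card using Nat.strong_induction_on generalizing A θ vt L e with
  | _ n IH =>
  subst hn
  replace IH : ∀ (A' : Finset D) (θ' : D → D) (vt' : D → V) (L' : D → Prop) (e' : D),
      A'.card < A.card → IsCubic A' θ' vt' → IsEven A' θ' vt' L' → e' ∈ A' →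
      Quellable A' θ' vt' L' e' := fun A' θ' vt' L' e' h G' E' h' => IH _ h G' E' h' rfl
  by_cases hlt : A.card < 18
  · exact .of_card_lt G hlt he
  by_cases hcut : ∃ U, cutCard A θ vt U = 3 ∧ 3 < dartCount A vt U ∧
      3 < dartCount A vt fun x => ¬ U x
  · have inside : ∀ U : V → Prop, cutCard A θ vt U = 3 → 3 < dartCount A vt U →
        ∃ d ∈ A, U (vt d) ∧ U (vt (θ d)) := by
      intro U h3 hd
      by_contra! hcon
      have : dartCount A vt U ≤ cutCard A θ vt U := by
        unfold dartCount cutCard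
        refine Finset.card_le_card fun d hd => ?_
        simp only [Finset.mem_filter] at hd ⊢
        exact ⟨hd.1, hd.2, hcon d hd.1 hd.2⟩
      omega
    obtain ⟨U, h3, hd, hd', hU⟩ : ∃ U, cutCard A θ vt U = 3 ∧ 3 < dartCount A vt U ∧
        (3 < dartCount A vt fun x => ¬ U x) ∧ U (vt e) := by
      obtain ⟨U, h3, hd, hd'⟩ := hcut
      by_cases hU : U (vt e)
      · exact ⟨U, h3, hd, hd', hU⟩
      · refine ⟨fun x => ¬ U x, by rw [cutCard_compl G, h3], hd', ?_, hU⟩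
        simpa only [not_not] using hd
    have h3' : cutCard A θ vt (fun x => ¬ U x) = 3 := by rw [cutCard_compl G, h3]
    obtain ⟨d, hdA, d1, d2⟩ := inside U h3 hd
    obtain ⟨d', hdA', d1', d2'⟩ := inside _ h3' hd'
    refine .of_cut G E h3 hU (fun w hw => ?_) fun w hw m hm => ?_
    · exact IH _ _ _ _ _ (contractDarts_card_lt hdA' d1' d2') (G.contract hw h3)
        (E.contract G hw) (by simp [contractDarts, he, hU])
    · have hw' : ¬ ¬ U w := not_not.2 hw
      exact IH _ _ _ _ _ (contractDarts_card_lt hdA (not_not.2 d1) (not_not.2 d2))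
        (G.contract hw' h3') (E.contract G hw') hm
  have S : IsSolid A θ vt := ⟨G, by omega, fun U h3 => by
    by_contra! h
    exact hcut ⟨U, h3, h⟩⟩
  have E' : IsEven A θ vt fun d => L d ∧ d ∈ A := by
    refine ⟨fun d hd h => ⟨E.symm d hd h.1, G.mem d hd⟩, fun d hd => ?_⟩
    have h0 := E.even d hd
    refine (congrArg (fun s : Finset D => Even s.card) ?_).mpr h0
    ext x
    simp only [Finset.mem_filter]
    tauto
  obtain ⟨M, c, P, hM, C⟩ := S.quellable E' (fun _ h => h.2) (fun A' θ' L' e' => IH A' θ' vt L' e')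
    he
  exact ⟨M, c, P, hM, fun d hd hL => C d hd ⟨hL, hd⟩⟩

end Quellable

open scoped Classical in
/-- The number of darts at `v` with property `P`. -/
noncomputable def degCount {D V : Type*} [Fintype D] (vt : D → V) (P : D → Prop) (v : V) : ℕ :=
  (Finset.univ.filter fun d => vt d = v ∧ P d).card

/-- A 2-connected multigraph, given by its dart involution `θ`, in which the vertex `v` has degree
`3 * f v`, together with a set of edge-disjoint closed trails, described by the map `π` that swaps
the two darts of every passage of a trail through a vertex and fixes all other darts. -/
structure IsTrailSystem {D V : Type*} [Fintype D] (θ π : D → D) (vt : D → V) (f : V → ℕ) :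
    Prop where
  inv : ∀ d, θ (θ d) = d
  ne : ∀ d, θ d ≠ d
  swap : ∀ d, π (π d) = d
  vt_swap : ∀ d, vt (π d) = vt d
  fixed : ∀ d, π d = d → π (θ d) = θ d
  card : ∀ v, degCount vt (fun _ => True) v = 3 * f v
  block : ∀ (U : D → Prop) (v : V), (∀ d, U d → U (θ d)) →
    (∀ x y, vt x = vt y → vt x ≠ v → U x → U y) → ∀ x y, vt x = v → vt y = v → U x → U y

/-- Some `f`-factor through `e` meets every odd trail, as witnessed by a colouring of the darts. -/
def FactorThrough {D V : Type*} [Fintype D] (θ π : D → D) (vt : D → V) (f : V → ℕ) (e : D) :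
    Prop :=
  ∃ (F : D → Prop) (c : D → Bool), (∀ d, F d → F (θ d)) ∧ F e ∧
    (∀ v, degCount vt F v = f v) ∧
    (∀ d, c (π d) = c d) ∧ ∀ d, π d ≠ d → ¬ F d → c d ≠ c (θ d)

namespace IsTrailSystem

variable {D : Type*} [Fintype D] {θ π : D → D} {vt : D → V} {f : V → ℕ}

open scoped Classical in
lemma card_filter (T : IsTrailSystem θ π vt f) (v : V) :
    (Finset.univ.filter fun d => vt d = v).card = 3 * f v := by
  simpa only [degCount, and_true] using T.card v

lemma factorThrough_of_le_one (T : IsTrailSystem θ π vt f) (hf : ∀ v, f v ≤ 1) (e : D) :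
    FactorThrough θ π vt f e := by
  classical
  have hpos : ∀ d, f (vt d) = 1 := fun d => by
    have h := T.card_filter (vt d)
    have : 0 < (Finset.univ.filter fun x => vt x = vt d).card :=
      Finset.card_pos.2 ⟨d, by simp⟩
    have h' : (Finset.univ.filter fun x => vt x = vt d).card = 3 * f (vt d) := by convert h
    have := hf (vt d)
    omega
  have G : IsCubic Finset.univ θ vt := by
    refine ⟨fun _ _ => Finset.mem_univ _, fun d _ => T.inv d, fun d _ => T.ne d, fun d _ => ?_,
      fun U hU => ?_⟩
    · have := T.card_filter (vt d)
      rw [hpos] at this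
      exact this
    · unfold cutCard at hU
      obtain ⟨d, hd⟩ := Finset.card_eq_one.1 hU
      have key : ∀ x, U (vt x) ∧ ¬ U (vt (θ x)) ↔ x = d := fun x => by
        have := congrArg (fun s => x ∈ s) hd
        simpa using this
      obtain ⟨hd1, hd2⟩ := (key d).2 rfl
      have h3 : (Finset.univ.filter fun x => vt x = vt d).card = 3 := by
        have := T.card_filter (vt d)
        rw [hpos] at this
        convert this
      obtain ⟨y, hy, hyd⟩ := Finset.exists_mem_ne (by omega) d (s :=
        Finset.univ.filter fun x => vt x = vt d)
      replace hy := (Finset.mem_filter.1 hy).2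
      refine (T.block (fun x => U (vt x) ∧ x ≠ d) (vt d) ?_ ?_ y d hy rfl ⟨hy ▸ hd1, hyd⟩).2 rfl
      · rintro x ⟨hx, hxd⟩
        refine ⟨?_, ?_⟩
        · by_contra h
          exact hxd ((key x).1 ⟨hx, h⟩)
        · rintro rfl
          exact hd2 (by rwa [T.inv])
      · rintro x y hxy hx ⟨h, -⟩
        exact ⟨hxy ▸ h, fun h' => hx (by rw [hxy, h'])⟩
  have E : IsEven Finset.univ θ vt fun d => π d ≠ d := by
    refine ⟨fun d _ h h' => h ?_, fun d _ => ?_⟩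
    · have := T.fixed _ h'
      rwa [T.inv] at this
    · refine even_card_of_involution π ?_ (fun x _ => T.swap x) ?_
      · intro x hx
        simp only [Finset.mem_filter, Finset.mem_univ, true_and] at hx ⊢
        exact ⟨by rw [T.vt_swap, hx.1], fun h => hx.2 (by rwa [T.swap, eq_comm] at h)⟩
      · intro x hx
        simp only [Finset.mem_filter, Finset.mem_univ, true_and] at hx
        exact hx.2
  obtain ⟨M, c, P, hM, C⟩ := G.quellable E (Finset.mem_univ e)
  refine ⟨M, fun d => c (vt d), P.symm, hM, fun v => ?_, fun d => by simp only [T.vt_swap],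
    fun d hd => C d (Finset.mem_univ d) hd⟩
  by_cases hv : ∃ d, vt d = v
  · obtain ⟨d, rfl⟩ := hv
    rw [hpos, degCount, Finset.card_eq_one]
    obtain ⟨x, hx, hxd⟩ := P.ex d (Finset.mem_univ d)
    refine ⟨x, ?_⟩
    ext y
    simp only [Finset.mem_filter, Finset.mem_univ, true_and, Finset.mem_singleton]
    constructor
    · rintro ⟨h, hy⟩
      exact P.uniq _ _ hy hx (h.trans hxd.symm)
    · rintro rfl
      exact ⟨hxd, hx⟩
  · push Not at hv
    have h := T.card_filter v
    rw [Finset.filter_false_of_mem (by simpa using hv), Finset.card_empty] at h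
    rw [degCount, Finset.filter_false_of_mem (by simp [hv]), Finset.card_empty]
    omega

end IsTrailSystem

lemma exists_closed_pair {D : Type*} {π : D → D} (hπ : ∀ d, π (π d) = d) {s : Finset D}
    (hs : ∀ d ∈ s, π d ∈ s) (h : 2 ≤ s.card) :
    ∃ x ∈ s, ∃ y ∈ s, x ≠ y ∧ ∀ d, π d = x ∨ π d = y ↔ d = x ∨ d = y := by
  have key : ∀ d x, π d = x ↔ d = π x := fun d x =>
    ⟨fun h => by rw [← h, hπ], fun h => by rw [h, hπ]⟩
  by_cases hd : ∃ d ∈ s, π d ≠ d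
  · obtain ⟨d, hd, hne⟩ := hd
    refine ⟨d, hd, π d, hs d hd, hne.symm, fun z => ?_⟩
    rw [key, key, hπ, or_comm]
  · push Not at hd
    obtain ⟨x, hx, y, hy, hxy⟩ := Finset.one_lt_card.1 h
    refine ⟨x, hx, y, hy, hxy, fun z => ?_⟩
    rw [key, key, hd x hx, hd y hy]

section Split

variable {D : Type*} {θ π : D → D} {vt : D → V} {f : V → ℕ}

/-- The edge involution after splitting off two pairs of darts from a vertex. -/
def splitInv (θ : D → D) : D ⊕ Fin 6 → D ⊕ Fin 6
  | .inl d => .inl (θ d)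
  | .inr i => .inr (![1, 0, 3, 2, 5, 4] i)

/-- The trails after splitting off two pairs of darts from a vertex. -/
def splitSwap (π : D → D) : D ⊕ Fin 6 → D ⊕ Fin 6
  | .inl d => .inl (π d)
  | .inr i => .inr i

open scoped Classical in
/-- The dart origins after splitting off the pairs `d₁, d₂` and `d₃, d₄` from the vertex `v`. -/
noncomputable def splitVt (vt : D → V) (v : V) (d₁ d₂ d₃ d₄ : D) : D ⊕ Fin 6 → V ⊕ Fin 3
  | .inl d => if d = d₁ ∨ d = d₂ then .inr 0 else if d = d₃ ∨ d = d₄ then .inr 1 else .inl (vt d)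
  | .inr i => ![.inr 0, .inr 2, .inr 1, .inr 2, .inr 2, .inl v] i

open scoped Classical in
/-- The degree function after splitting off two pairs of darts from the vertex `v`. -/
noncomputable def splitFun (f : V → ℕ) (v : V) : V ⊕ Fin 3 → ℕ
  | .inl w => if w = v then f v - 1 else f w
  | .inr _ => 1

/-- The pairs `d₁, d₂` and `d₃, d₄` can be split off from `v`. -/
structure IsSplitting (π : D → D) (vt : D → V) (v : V) (d₁ d₂ d₃ d₄ : D) : Prop where
  v₁ : vt d₁ = v
  v₂ : vt d₂ = v
  v₃ : vt d₃ = v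
  v₄ : vt d₄ = v
  n₁₂ : d₁ ≠ d₂
  n₁₃ : d₁ ≠ d₃
  n₁₄ : d₁ ≠ d₄
  n₂₃ : d₂ ≠ d₃
  n₂₄ : d₂ ≠ d₄
  n₃₄ : d₃ ≠ d₄
  closed : ∀ d, π d = d₁ ∨ π d = d₂ ↔ d = d₁ ∨ d = d₂
  closed' : ∀ d, π d = d₃ ∨ π d = d₄ ↔ d = d₃ ∨ d = d₄

namespace IsSplitting

variable {v : V} {d₁ d₂ d₃ d₄ : D}

lemma splitVt_inl_eq_zero (d : D) :
    splitVt vt v d₁ d₂ d₃ d₄ (.inl d) = .inr 0 ↔ d = d₁ ∨ d = d₂ := by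
  simp only [splitVt]
  split_ifs <;> simp [*]

lemma splitVt_inl_eq_one (S : IsSplitting π vt v d₁ d₂ d₃ d₄) (d : D) :
    splitVt vt v d₁ d₂ d₃ d₄ (.inl d) = .inr 1 ↔ d = d₃ ∨ d = d₄ := by
  have h1 : d = d₁ ∨ d = d₂ → ¬ (d = d₃ ∨ d = d₄) := by
    rintro (rfl | rfl)
    · simp [S.n₁₃, S.n₁₄]
    · simp [S.n₂₃, S.n₂₄]
  simp only [splitVt]
  split_ifs <;> simp [*]

lemma splitVt_inl_ne_two (d : D) : splitVt vt v d₁ d₂ d₃ d₄ (.inl d) ≠ .inr 2 := by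
  simp only [splitVt]
  split_ifs <;> simp

lemma splitVt_inl_eq_inl (d : D) (w : V) : splitVt vt v d₁ d₂ d₃ d₄ (.inl d) = .inl w ↔
    vt d = w ∧ ¬ (d = d₁ ∨ d = d₂) ∧ ¬ (d = d₃ ∨ d = d₄) := by
  simp only [splitVt]
  split_ifs <;> simp [*]

open scoped Classical in
/-- Counting darts with a property at the vertices arising from a splitting. -/
lemma card_filter [Fintype D] (S : IsSplitting π vt v d₁ d₂ d₃ d₄)
    (P : D ⊕ Fin 6 → Prop) :
    let n (x : D ⊕ Fin 6) : ℕ := if P x then 1 else 0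
    let N := degCount (splitVt vt v d₁ d₂ d₃ d₄) P
    let N₀ := degCount vt fun d => P (.inl d)
    N (.inr 0) = n (.inl d₁) + n (.inl d₂) + n (.inr 0) ∧
    N (.inr 1) = n (.inl d₃) + n (.inl d₄) + n (.inr 2) ∧
    N (.inr 2) = n (.inr 1) + n (.inr 3) + n (.inr 4) ∧
    N (.inl v) + n (.inl d₁) + n (.inl d₂) + n (.inl d₃) + n (.inl d₄) = N₀ v + n (.inr 5) ∧
    ∀ w, w ≠ v → N (.inl w) = N₀ w := by
  intro n N N₀
  have hN : ∀ w, N w = (Finset.univ.filter fun d =>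
      splitVt vt v d₁ d₂ d₃ d₄ (.inl d) = w ∧ P (.inl d)).card +
      ∑ i : Fin 6, if splitVt vt v d₁ d₂ d₃ d₄ (.inr i) = w ∧ P (.inr i) then 1 else 0 := by
    intro w
    simp only [N, degCount, Finset.card_filter]
    rw [Fintype.sum_sum_type]
    congr!
  obtain ⟨v1, v2, v3, v4, n12, n13, n14, n23, n24, n34, -, -⟩ := id S
  have pair : ∀ x y : D, x ≠ y → (Finset.univ.filter fun d => (d = x ∨ d = y) ∧ P (.inl d)).card =
      n (.inl x) + n (.inl y) := by
    intro x y hxy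
    rw [Finset.card_filter, ← Finset.sum_subset (Finset.subset_univ {x, y}),
      Finset.sum_pair hxy]
    · simp [n]
    · intro d _ hd
      simp only [Finset.mem_insert, Finset.mem_singleton] at hd
      simp [hd]
  have e0 := splitVt_inl_eq_zero (vt := vt) (v := v) (d₁ := d₁) (d₂ := d₂) (d₃ := d₃) (d₄ := d₄)
  have e1 := S.splitVt_inl_eq_one
  have e2 : ∀ d, splitVt vt v d₁ d₂ d₃ d₄ (.inl d) ≠ .inr 2 := splitVt_inl_ne_two
  have e3 := splitVt_inl_eq_inl (vt := vt) (v := v) (d₁ := d₁) (d₂ := d₂) (d₃ := d₃) (d₄ := d₄)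
  refine ⟨?_, ?_, ?_, ?_, ?_⟩
  · rw [hN]
    simp only [e0, pair _ _ n12]
    simp [splitVt, Fin.sum_univ_six, n]
  · rw [hN]
    simp only [e1, pair _ _ n34]
    simp [splitVt, Fin.sum_univ_six, n]
  · rw [hN]
    simp only [e2]
    simp [splitVt, Fin.sum_univ_six, n, add_assoc]
  · rw [hN]
    have h : (Finset.univ.filter fun d =>
        splitVt vt v d₁ d₂ d₃ d₄ (.inl d) = .inl v ∧ P (.inl d)).card +
        (Finset.univ.filter fun d => (d = d₁ ∨ d = d₂) ∧ P (.inl d)).card +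
        (Finset.univ.filter fun d => (d = d₃ ∨ d = d₄) ∧ P (.inl d)).card = N₀ v := by
      simp only [N₀, degCount, Finset.card_filter, e3]
      rw [← Finset.sum_add_distrib, ← Finset.sum_add_distrib]
      refine Finset.sum_congr rfl fun d _ => ?_
      by_cases hP : P (.inl d)
      · by_cases h1 : d = d₁
        · subst h1; simp [*]
        by_cases h2 : d = d₂
        · subst h2; simp [*, Ne.symm]
        by_cases h3 : d = d₃
        · subst h3; simp [*]
        by_cases h4 : d = d₄
        · subst h4; simp [*]
        simp [*]
      · simp [hP]
    rw [pair _ _ n12, pair _ _ n34] at h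
    simp [splitVt, Fin.sum_univ_six, n] at h ⊢
    omega
  · intro w hw
    rw [hN]
    have h : ∀ d, vt d = w → d ≠ d₁ ∧ d ≠ d₂ ∧ d ≠ d₃ ∧ d ≠ d₄ := by
      rintro d rfl
      refine ⟨?_, ?_, ?_, ?_⟩ <;> rintro rfl <;> contradiction
    have h' : ∀ d, (vt d = w ∧ ¬ (d = d₁ ∨ d = d₂) ∧ ¬ (d = d₃ ∨ d = d₄)) ↔ vt d = w := by
      intro d
      constructor
      · exact fun h => h.1
      · intro hd
        have := h d hd
        tauto
    simp only [e3, h']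
    simp [splitVt, Fin.sum_univ_six, hw.symm, N₀, degCount]

end IsSplitting

end Split

section Split

variable {D : Type*} [Fintype D] {θ π : D → D} {vt : D → V} {f : V → ℕ} {v : V} {d₁ d₂ d₃ d₄ : D}

open scoped Classical in
lemma IsTrailSystem.exists_splitting (T : IsTrailSystem θ π vt f) (hv : 2 ≤ f v) :
    ∃ d₁ d₂ d₃ d₄, IsSplitting π vt v d₁ d₂ d₃ d₄ := by
  set s := Finset.univ.filter fun d => vt d = v with hs
  have hmem : ∀ d, d ∈ s ↔ vt d = v := by simp [hs]
  have hcard : s.card = 3 * f v := T.card_filter v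
  obtain ⟨x, hx, y, hy, hxy, h1⟩ := exists_closed_pair T.swap (s := s)
    (fun d hd => (hmem _).2 (by rw [T.vt_swap, (hmem d).1 hd])) (by omega)
  obtain ⟨z, hz, w, hw, hzw, h2⟩ := exists_closed_pair T.swap (s := (s.erase x).erase y)
    (fun d hd => by
      simp only [Finset.mem_erase, hmem, T.vt_swap] at hd ⊢
      have := h1 d
      tauto)
    (by
      rw [Finset.card_erase_of_mem (Finset.mem_erase.2 ⟨hxy.symm, hy⟩), Finset.card_erase_of_mem hx]
      omega)
  simp only [Finset.mem_erase, hmem] at hx hy hz hw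
  exact ⟨x, y, z, w, hx, hy, hz.2.2, hw.2.2, hxy, hz.2.1.symm, hw.2.1.symm, hz.1.symm, hw.1.symm,
    hzw, h1, h2⟩

open scoped Classical in
lemma IsTrailSystem.split_block (T : IsTrailSystem θ π vt f) (S : IsSplitting π vt v d₁ d₂ d₃ d₄)
    (hv : 2 ≤ f v) (U : D ⊕ Fin 6 → Prop) (w : V ⊕ Fin 3)
    (hU : ∀ d, U d → U (splitInv θ d))
    (hW : ∀ x y, splitVt vt v d₁ d₂ d₃ d₄ x = splitVt vt v d₁ d₂ d₃ d₄ y →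
      splitVt vt v d₁ d₂ d₃ d₄ x ≠ w → U x → U y) (x y : D ⊕ Fin 6)
    (hx : splitVt vt v d₁ d₂ d₃ d₄ x = w) (hy : splitVt vt v d₁ d₂ d₃ d₄ y = w) (hUx : U x) :
    U y := by
  obtain ⟨r, hr, hr'⟩ : ∃ r, vt r = v ∧ r ∉ ({d₁, d₂, d₃, d₄} : Finset D) := by
    have h4 : ({d₁, d₂, d₃, d₄} : Finset D).card < (Finset.univ.filter fun d => vt d = v).card := by
      rw [T.card_filter]
      exact Finset.card_le_four.trans_lt (by omega)
    obtain ⟨r, hr, hr'⟩ := Finset.exists_mem_notMem_of_card_lt_card h4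
    exact ⟨r, by simpa using hr, hr'⟩
  simp only [Finset.mem_insert, Finset.mem_singleton, not_or] at hr'
  obtain ⟨r1, r2, r3, r4⟩ := hr'
  have A : ∀ x y, splitVt vt v d₁ d₂ d₃ d₄ x = splitVt vt v d₁ d₂ d₃ d₄ y →
      splitVt vt v d₁ d₂ d₃ d₄ x ≠ w → (U x ↔ U y) := fun x y h h' =>
    ⟨hW x y h h', hW y x h.symm (h ▸ h')⟩
  have s01 : U (.inr 0) ↔ U (.inr 1) := ⟨hU (.inr 0), hU (.inr 1)⟩
  have s23 : U (.inr 2) ↔ U (.inr 3) := ⟨hU (.inr 2), hU (.inr 3)⟩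
  have s45 : U (.inr 4) ↔ U (.inr 5) := ⟨hU (.inr 4), hU (.inr 5)⟩
  have t1 : splitVt vt v d₁ d₂ d₃ d₄ (.inl d₁) = .inr 0 :=
    (IsSplitting.splitVt_inl_eq_zero _).2 (.inl rfl)
  have t2 : splitVt vt v d₁ d₂ d₃ d₄ (.inl d₂) = .inr 0 :=
    (IsSplitting.splitVt_inl_eq_zero _).2 (.inr rfl)
  have t3 : splitVt vt v d₁ d₂ d₃ d₄ (.inl d₃) = .inr 1 :=
    (IsSplitting.splitVt_inl_eq_one S _).2 (.inl rfl)
  have t4 : splitVt vt v d₁ d₂ d₃ d₄ (.inl d₄) = .inr 1 :=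
    (IsSplitting.splitVt_inl_eq_one S _).2 (.inr rfl)
  have tr : splitVt vt v d₁ d₂ d₃ d₄ (.inl r) = .inl v :=
    (IsSplitting.splitVt_inl_eq_inl _ _).2 ⟨hr, by tauto, by tauto⟩
  have toff : ∀ d, vt d ≠ v → splitVt vt v d₁ d₂ d₃ d₄ (.inl d) = .inl (vt d) := fun d hd =>
    (IsSplitting.splitVt_inl_eq_inl _ _).2 ⟨rfl, by rintro (rfl | rfl); exacts [hd S.v₁, hd S.v₂],
      by rintro (rfl | rfl); exacts [hd S.v₃, hd S.v₄]⟩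
  have h0 : .inr 0 ≠ w → (U (.inl d₁) ↔ U (.inr 0)) ∧ (U (.inl d₂) ↔ U (.inr 0)) := fun h =>
    ⟨A _ _ t1 (t1 ▸ h), A _ _ t2 (t2 ▸ h)⟩
  have h1 : .inr 1 ≠ w → (U (.inl d₃) ↔ U (.inr 2)) ∧ (U (.inl d₄) ↔ U (.inr 2)) := fun h =>
    ⟨A _ _ t3 (t3 ▸ h), A _ _ t4 (t4 ▸ h)⟩
  have h2 : .inr 2 ≠ w → (U (.inr 1) ↔ U (.inr 3)) ∧ (U (.inr 1) ↔ U (.inr 4)) := fun h =>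
    ⟨A (.inr 1) (.inr 3) rfl h, A (.inr 1) (.inr 4) rfl h⟩
  have h3 : .inl v ≠ w → (U (.inl r) ↔ U (.inr 5)) := fun h => A _ (.inr 5) tr (tr ▸ h)
  have const : ∀ d, vt d = v → (U (.inl d) ↔ U (.inl r)) := by
    by_cases hw : ∃ z, z ≠ v ∧ w = .inl z
    · obtain ⟨z, hz, rfl⟩ := hw
      have h0 := h0 (by simp)
      have h1 := h1 (by simp)
      have h2 := h2 (by simp)
      have h3 := h3 (by simpa using hz.symm)
      have e1 : U (.inr 0) ↔ U (.inl r) := s01.trans (h2.2.trans (s45.trans h3.symm))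
      have e2 : U (.inr 2) ↔ U (.inl r) := s23.trans (h2.1.symm.trans (s01.symm.trans e1))
      intro d hd
      by_cases hd1 : d = d₁ ∨ d = d₂
      · rcases hd1 with rfl | rfl
        exacts [h0.1.trans e1, h0.2.trans e1]
      by_cases hd2 : d = d₃ ∨ d = d₄
      · rcases hd2 with rfl | rfl
        exacts [h1.1.trans e2, h1.2.trans e2]
      have td := (IsSplitting.splitVt_inl_eq_inl (vt := vt) (v := v) d v).2 ⟨hd, hd1, hd2⟩
      exact A _ _ (td.trans tr.symm) (by rw [td]; simpa using hz.symm)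
    · push Not at hw
      have B : ∀ x y, vt x = vt y → vt x ≠ v → U (.inl x) → U (.inl y) := fun x y hxy hx =>
        hW _ _ (by rw [toff x hx, toff y (hxy ▸ hx), hxy])
          (by rw [toff x hx]; exact (hw _ hx).symm)
      exact fun d hd => ⟨T.block (fun d => U (.inl d)) v (fun d => hU (.inl d)) B d r hd hr,
        T.block (fun d => U (.inl d)) v (fun d => hU (.inl d)) B r d hr hd⟩
  have c1 := const d₁ S.v₁
  have c3 := const d₃ S.v₃
  by_cases hw : ∃ z, z ≠ v ∧ w = .inl z
  · obtain ⟨z, hz, rfl⟩ := hw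
    have hinl : ∀ x, splitVt vt v d₁ d₂ d₃ d₄ x = .inl z → ∃ d, x = .inl d ∧ vt d = z := by
      rintro (d | i) h
      · exact ⟨d, rfl, ((IsSplitting.splitVt_inl_eq_inl _ _).1 h).1⟩
      · fin_cases i <;> simp [splitVt] at h
        exact absurd h.symm hz
    obtain ⟨x, rfl, hxz⟩ := hinl x hx
    obtain ⟨y, rfl, hyz⟩ := hinl y hy
    refine T.block (fun d => U (.inl d)) z (fun d => hU (.inl d)) (fun a b hab ha => ?_) x y hxz hyz
      hUx
    by_cases hav : vt a = v
    · exact ((const a hav).trans (const b (hab ▸ hav)).symm).1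
    · refine hW _ _ ?_ ?_
      · rw [toff a hav, toff b (hab ▸ hav), hab]
      · rw [toff a hav]
        simpa using ha
  · have stem : ∀ i, U (.inr i) ↔ U (.inl r) := by
      have hall : (U (.inr 0) ↔ U (.inl r)) ∧ (U (.inr 2) ↔ U (.inl r)) ∧
          (U (.inr 4) ↔ U (.inl r)) := by
        have g0 (h : .inr 0 ≠ w) : U (.inr 0) ↔ U (.inl r) := (h0 h).1.symm.trans c1
        have g2 (h : .inr 1 ≠ w) : U (.inr 2) ↔ U (.inl r) := (h1 h).1.symm.trans c3
        have g4 (h : .inl v ≠ w) : U (.inr 4) ↔ U (.inl r) := s45.trans (h3 h).symm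
        rcases w with z | i
        · obtain ⟨-, h4⟩ := h2 (by simp)
          have g0 := g0 (by simp)
          exact ⟨g0, g2 (by simp), h4.symm.trans (s01.symm.trans g0)⟩
        · replace g4 := g4 (by simp)
          fin_cases i
          · exact ⟨s01.trans ((h2 (by simp)).2.trans g4), g2 (by simp), g4⟩
          · exact ⟨g0 (by simp),
              s23.trans ((h2 (by simp)).1.symm.trans ((h2 (by simp)).2.trans g4)), g4⟩
          · exact ⟨g0 (by simp), g2 (by simp), g4⟩
      obtain ⟨g0, g2, g4⟩ := hall
      intro i
      fin_cases i
      exacts [g0, s01.symm.trans g0, g2, s23.symm.trans g2, g4, s45.symm.trans g4]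
    have stays : ∀ x, splitVt vt v d₁ d₂ d₃ d₄ x = w → (U x ↔ U (.inl r)) := by
      rintro (d | i) h
      · refine const d ?_
        by_contra hd
        exact hw ⟨vt d, hd, by rw [← h, toff d hd]⟩
      · exact stem i
    exact (stays y hy).2 ((stays x hx).1 hUx)

lemma IsTrailSystem.split (T : IsTrailSystem θ π vt f) (S : IsSplitting π vt v d₁ d₂ d₃ d₄)
    (hv : 2 ≤ f v) :
    IsTrailSystem (splitInv θ) (splitSwap π) (splitVt vt v d₁ d₂ d₃ d₄) (splitFun f v) := by
  classical
  refine ⟨?_, ?_, ?_, ?_, ?_, ?_, T.split_block S hv⟩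
  · rintro (d | i)
    · simp [splitInv, T.inv]
    · fin_cases i <;> simp [splitInv]
  · rintro (d | i)
    · simp [splitInv, T.ne]
    · fin_cases i <;> simp [splitInv]
  · rintro (d | i) <;> simp [splitSwap, T.swap]
  · rintro (d | i)
    · simp only [splitSwap, splitVt, S.closed, S.closed', T.vt_swap]
    · rfl
  · rintro (d | i) h
    · simp only [splitInv, splitSwap, Sum.inl.injEq] at h ⊢
      exact T.fixed d h
    · fin_cases i <;> rfl
  · obtain ⟨h0, h1, h2, h3, h4⟩ := IsSplitting.card_filter S fun _ => True
    simp only [if_true, T.card] at h0 h1 h2 h3 h4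
    rintro (w | i)
    · by_cases hw : w = v
      · subst hw
        simp only [splitFun, if_true]
        omega
      · simp only [splitFun, hw, if_false, h4 w hw]
    · fin_cases i
      · exact h0
      · exact h1
      · exact h2

lemma FactorThrough.of_split (S : IsSplitting π vt v d₁ d₂ d₃ d₄) (hv : 2 ≤ f v) {e : D}
    (h : FactorThrough (splitInv θ) (splitSwap π) (splitVt vt v d₁ d₂ d₃ d₄) (splitFun f v)
      (.inl e)) : FactorThrough θ π vt f e := by
  classical
  obtain ⟨F, c, hF, he, hcard, hc, C⟩ := h
  obtain ⟨h0, h1, h2, h3, h4⟩ := IsSplitting.card_filter S F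
  have f01 : F (.inr 0) ↔ F (.inr 1) := ⟨hF _, hF (.inr 1)⟩
  have f23 : F (.inr 2) ↔ F (.inr 3) := ⟨hF _, hF (.inr 3)⟩
  have f45 : F (.inr 4) ↔ F (.inr 5) := ⟨hF _, hF (.inr 5)⟩
  refine ⟨fun d => F (.inl d), fun d => c (.inl d), fun d => hF (.inl d), he, fun w => ?_,
    fun d => hc (.inl d), fun d hd => C (.inl d) (by simpa [splitSwap] using hd)⟩
  by_cases hw : w = v
  · subst hw
    simp only [hcard, splitFun, if_true, ← f01, ← f23, ← f45] at h0 h1 h2 h3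
    omega
  · rw [← h4 w hw, hcard]
    simp [splitFun, hw]

end Split

lemma IsTrailSystem.factorThrough {D : Type*} {V : Type*} [Fintype D] [Fintype V] {θ π : D → D}
    {vt : D → V} {f : V → ℕ} (T : IsTrailSystem θ π vt f) (e : D) :
    FactorThrough θ π vt f e := by
  classical
  induction hn : ∑ v, (f v - 1) using Nat.strong_induction_on generalizing D V with
  | _ n IH =>
  by_cases hf : ∀ v, f v ≤ 1
  · exact T.factorThrough_of_le_one hf e
  push Not at hf
  obtain ⟨v, hv⟩ := hf
  obtain ⟨d₁, d₂, d₃, d₄, S⟩ := T.exists_splitting (v := v) hv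
  refine .of_split S hv (IH _ ?_ (T.split S hv) (.inl e) rfl)
  rw [← hn, Fintype.sum_sum_type]
  simp only [splitFun, Nat.sub_self, Finset.sum_const_zero, add_zero]
  refine Finset.sum_lt_sum (fun w _ => ?_) ⟨v, Finset.mem_univ v, ?_⟩
  · split_ifs with h
    · subst h; omega
    · rfl
  · simp; omega

end DartGraph

section Simple

variable {G : SimpleGraph V} {𝒪 : Set G.Subgraph}

/-- The other dart with the same origin on the same cycle of `𝒪`. -/
lemma exists_turn (hodd : ∀ O ∈ 𝒪, IsOddCycleSG O) (hdisj : PairwiseEdgeDisjoint 𝒪) (d : G.Dart) :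
    ∃ d' : G.Dart, d'.fst = d.fst ∧ ((∀ O ∈ 𝒪, ¬ O.Adj d.fst d.snd) → d' = d) ∧
      ∀ O ∈ 𝒪, O.Adj d.fst d.snd → d' ≠ d ∧ O.Adj d'.fst d'.snd ∧
        ∀ x : G.Dart, x.fst = d.fst → O.Adj x.fst x.snd → x = d ∨ x = d' := by
  by_cases h : ∃ O ∈ 𝒪, O.Adj d.fst d.snd
  · obtain ⟨O, hO, hd⟩ := h
    obtain ⟨a, b, hab, hs⟩ := Set.ncard_eq_two.1 ((hodd O hO).1.2 d.fst hd.fst_mem)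
    have key : ∀ w, O.Adj d.fst w ↔ w = a ∨ w = b := fun w => by
      rw [← O.mem_neighborSet, hs]
      simp
    obtain ⟨w, hw, hwd, hall⟩ : ∃ w, O.Adj d.fst w ∧ w ≠ d.snd ∧
        ∀ x, O.Adj d.fst x → x = d.snd ∨ x = w := by
      rcases (key _).1 hd with h | h
      · exact ⟨b, (key b).2 (.inr rfl), by rw [h]; exact hab.symm, fun x hx => h ▸ (key x).1 hx⟩
      · exact ⟨a, (key a).2 (.inl rfl), by rw [h]; exact hab, fun x hx => h ▸ ((key x).1 hx).symm⟩
    refine ⟨⟨(d.fst, w), hw.adj_sub⟩, rfl, fun h => absurd hd (h O hO), fun O' hO' hd' => ?_⟩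
    obtain rfl : O' = O := by
      by_contra hne
      have hd'' : s(d.fst, d.snd) ∈ O'.edgeSet := hd'
      exact Set.disjoint_left.1 (hdisj hO' hO hne) hd'' hd
    refine ⟨fun h => hwd (congrArg (fun x : G.Dart => x.snd) h), hw, fun x hx hxO => ?_⟩
    rcases hall x.snd (hx ▸ hxO) with h | h
    · exact .inl (Dart.ext _ _ (Prod.ext hx h))
    · exact .inr (Dart.ext _ _ (Prod.ext hx h))
  · push Not at h
    exact ⟨d, rfl, fun _ => rfl, fun O hO hd => absurd hd (h O hO)⟩

lemma degCount_dart [Fintype G.Dart] (P : G.Dart → Prop) (v : V) :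
    DartGraph.degCount (fun d : G.Dart => d.fst) P v =
      {w | ∃ h : G.Adj v w, P ⟨(v, w), h⟩}.ncard := by
  classical
  rw [DartGraph.degCount, ← Set.ncard_coe_finset]
  refine Set.ncard_congr (fun d _ => d.snd) ?_ ?_ ?_
  · rintro ⟨⟨u, w⟩, h⟩ hd
    simp only [Finset.coe_filter, Finset.mem_univ, true_and, Set.mem_ofPred_eq] at hd
    obtain ⟨rfl, hP⟩ := hd
    exact ⟨h, hP⟩
  · rintro ⟨⟨u, w⟩, h⟩ ⟨⟨u', w'⟩, h'⟩ hd hd' (hw : w = w')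
    simp only [Finset.coe_filter, Finset.mem_univ, true_and, Set.mem_ofPred_eq] at hd hd'
    obtain ⟨rfl, -⟩ := hd
    obtain ⟨rfl, -⟩ := hd'
    subst hw
    rfl
  · rintro w ⟨h, hP⟩
    exact ⟨⟨(v, w), h⟩, by simpa using hP, rfl⟩

lemma TwoConnected.block [Fintype V] (hG : TwoConnected G) (U : G.Dart → Prop) (v : V)
    (hU : ∀ d, U d → U d.symm) (hW : ∀ x y : G.Dart, x.fst = y.fst → x.fst ≠ v → U x → U y)
    (x y : G.Dart) (hx : x.fst = v) (hy : y.fst = v) (hUx : U x) : U y := by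
  have hxv : x.snd ≠ v := hx ▸ x.adj.ne'
  have hyv : y.snd ≠ v := hy ▸ y.adj.ne'
  have hr := (hG.2.2 v).preconnected ⟨x.snd, hxv⟩ ⟨y.snd, hyv⟩
  rw [reachable_iff_reflTransGen] at hr
  suffices h : ∀ z : {u | u ≠ v}, Relation.ReflTransGen (G.induce {u | u ≠ v}).Adj ⟨x.snd, hxv⟩ z →
      ∃ d : G.Dart, d.fst = z ∧ U d by
    obtain ⟨d, hd, hUd⟩ := h _ hr
    have := hU _ (hW d y.symm hd (by rw [hd]; exact hyv) hUd)
    rwa [Dart.symm_symm] at this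
  intro z hz
  induction hz with
  | refl => exact ⟨x.symm, rfl, hU x hUx⟩
  | @tail a b _ hab ih =>
    obtain ⟨d, hd, hUd⟩ := ih
    have hadj : G.Adj a b := hab
    exact ⟨⟨(b, a), hadj.symm⟩, rfl,
      hU _ (hW d ⟨(a, b), hadj⟩ hd (by rw [hd]; exact a.2) hUd)⟩

/-- In a 2-connected `3 * t`-regular graph, some `t`-factor through a given edge meets every member of
a given set of pairwise edge-disjoint odd cycles. -/
lemma exists_factor_meeting_odd_cycles [Fintype V] {t : ℕ} (hconn : TwoConnected G)
    (hreg : IsRegular G (3 * t)) (hodd : ∀ O ∈ 𝒪, IsOddCycleSG O)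
    (hdisj : PairwiseEdgeDisjoint 𝒪) (e : Sym2 V) (he : e ∈ G.edgeSet) :
    ∃ F : G.Subgraph, IsTFactor F t ∧ e ∈ F.edgeSet ∧
      ∀ O ∈ 𝒪, (F.edgeSet ∩ O.edgeSet).Nonempty := by
  classical
  choose π hfst hfix hcyc using exists_turn hodd hdisj
  have hswap : ∀ d, π (π d) = d := fun d => by
    by_cases h : ∃ O ∈ 𝒪, O.Adj d.fst d.snd
    · obtain ⟨O, hO, hd⟩ := h
      obtain ⟨h1, h2, -⟩ := hcyc d O hO hd
      obtain ⟨-, -, h3⟩ := hcyc (π d) O hO h2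
      exact ((h3 d (hfst d).symm hd).resolve_left h1.symm).symm
    · push Not at h
      rw [hfix d h, hfix d h]
  have hfixed : ∀ d, π d = d ↔ ∀ O ∈ 𝒪, ¬ O.Adj d.fst d.snd := fun d =>
    ⟨fun h O hO hd => (hcyc d O hO hd).1 h, hfix d⟩
  have T : DartGraph.IsTrailSystem (fun d : G.Dart => d.symm) π (fun d => d.fst) fun _ => t := by
    refine ⟨Dart.symm_symm, Dart.symm_ne, hswap, hfst, fun d hd => ?_, fun v => ?_, hconn.block⟩
    · rw [hfixed] at hd ⊢
      exact fun O hO h => hd O hO h.symm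
    · rw [degCount_dart, ← hreg v]
      congr 1
      ext w
      simp
  obtain ⟨a, b⟩ := e
  have hab : G.Adj a b := he
  obtain ⟨F, c, hF, hFe, hdeg, hc, C⟩ := T.factorThrough ⟨(a, b), hab⟩
  let H : G.Subgraph :=
    { verts := Set.univ
      Adj := fun u w => ∃ h : G.Adj u w, F ⟨(u, w), h⟩
      adj_sub := fun h => h.1
      edge_vert := fun _ => Set.mem_univ _
      symm := ⟨fun _ _ h => ⟨h.1.symm, hF _ h.2⟩⟩ }
  refine ⟨H, ⟨fun v => Set.mem_univ v, fun v => ?_⟩, ⟨hab, hFe⟩, fun O hO => ?_⟩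
  · exact (degCount_dart F v).symm.trans (hdeg v)
  · by_contra hne
    rw [Set.not_nonempty_iff_eq_empty, Set.eq_empty_iff_forall_notMem] at hne
    have hnF : ∀ d : G.Dart, O.Adj d.fst d.snd → ¬ F d := fun d hd hFd =>
      hne s(d.fst, d.snd) ⟨⟨d.adj, hFd⟩, hd⟩
    have hsymm : ∀ d : G.Dart, O.Adj d.fst d.snd → c d ≠ c d.symm := fun d hd =>
      C d (hcyc d O hO hd).1 (hnF d hd)
    refine Nat.not_even_iff_odd.2 (hodd O hO).2 ?_
    have key : (Finset.univ.filter fun d : G.Dart => O.Adj d.fst d.snd ∧ c d = true).card =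
        O.edgeSet.ncard := by
      rw [← Set.ncard_coe_finset]
      refine Set.ncard_congr (fun d _ => d.edge) ?_ ?_ ?_
      · intro d hd
        simp only [Finset.coe_filter, Finset.mem_univ, true_and, Set.mem_ofPred_eq] at hd
        exact hd.1
      · intro d d' hd hd' h
        simp only [Finset.coe_filter, Finset.mem_univ, true_and, Set.mem_ofPred_eq] at hd hd'
        rcases (dart_edge_eq_iff d d').1 h with h | rfl
        · exact h
        · exact absurd (hd.2.trans hd'.2.symm) (hsymm d' hd'.1).symm
      · rintro ⟨u, w⟩ (h : O.Adj u w)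
        cases hcd : c ⟨(u, w), h.adj_sub⟩ with
        | true => exact ⟨⟨(u, w), h.adj_sub⟩, by simpa using ⟨h, hcd⟩, rfl⟩
        | false =>
          refine ⟨⟨(w, u), h.symm.adj_sub⟩, ?_, Sym2.eq_swap⟩
          have := hsymm ⟨(u, w), h.adj_sub⟩ h
          rw [hcd] at this
          simpa using ⟨h.symm, Bool.eq_true_of_not_eq_false this.symm⟩
    rw [← key]
    refine DartGraph.even_card_of_involution π ?_ (fun x _ => hswap x) ?_
    · intro x hx
      simp only [Finset.mem_filter, Finset.mem_univ, true_and] at hx ⊢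
      exact ⟨(hcyc x O hO hx.1).2.1, by rw [hc, hx.2]⟩
    · intro x hx
      simp only [Finset.mem_filter, Finset.mem_univ, true_and] at hx
      exact (hcyc x O hO hx.1).1

end Simple

section Petersen

/-- Two fixed-point-free involutions of a finite set are flipped by a common 2-colouring. -/
lemma exists_colouring_of_involutions {D : Type*} [Finite D] {θ π : D → D}
    (hθ : Function.Involutive θ) (hπ : Function.Involutive π) (nθ : ∀ d, θ d ≠ d)
    (nπ : ∀ d, π d ≠ d) :
    ∃ c : D → Bool, (∀ d, c (θ d) = !c d) ∧ ∀ d, c (π d) = !c d := by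
  classical
  set a := hθ.toPerm with ha
  set φ := a * hπ.toPerm with hφ
  have haa : a * a = 1 := by ext d; exact hθ d
  have hbb : hπ.toPerm * hπ.toPerm = 1 := by ext d; exact hπ d
  have hinv : a⁻¹ = a := inv_eq_of_mul_eq_one_left haa
  have hconj : a * φ * a⁻¹ = φ⁻¹ := by
    rw [eq_comm, inv_eq_iff_mul_eq_one, hφ, hinv]
    calc a * hπ.toPerm * (a * (a * hπ.toPerm) * a)
        = a * (hπ.toPerm * ((a * a) * hπ.toPerm)) * a := by group
      _ = 1 := by rw [haa, one_mul, hbb, mul_one, haa]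
  have hpow : ∀ (i : ℤ) d, (φ ^ i) (θ d) = θ ((φ ^ (-i)) d) := fun i d => by
    have h : a * φ ^ (-i) * a⁻¹ = φ ^ i := by
      rw [← conj_zpow, hconj, inv_zpow', neg_neg]
    have := congrArg (fun σ : Equiv.Perm D => σ (θ d)) h
    simp only [hinv, Equiv.Perm.mul_apply] at this
    rw [← this]
    change θ ((φ ^ (-i)) (θ (θ d))) = _
    rw [hθ d]
  have hne : ∀ d, ¬ φ.SameCycle d (θ d) := by
    rintro d ⟨i, hi⟩
    obtain ⟨j, rfl | rfl⟩ := Int.even_or_odd' i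
    · refine nθ ((φ ^ j) d) ?_
      have := hpow (-j) d
      rw [← hi, neg_neg, ← Equiv.Perm.mul_apply, ← zpow_add] at this
      rw [← this]
      congr 2
      ring
    · refine nπ ((φ ^ j) d) (hθ.injective ?_)
      have := hpow (-j) d
      rw [← hi, neg_neg, ← Equiv.Perm.mul_apply, ← zpow_add] at this
      rw [← this, show -j + (2 * j + 1) = 1 + j by ring, zpow_add, zpow_one]
      rfl
  have hmap : ∀ x y, φ.SameCycle x y → φ.SameCycle (θ x) (θ y) := by
    rintro x y ⟨i, rfl⟩
    exact ⟨-i, by rw [hpow, neg_neg]⟩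
  let q : D → Quotient (Equiv.Perm.SameCycle.setoid φ) := Quotient.mk _
  obtain ⟨n, ⟨ι⟩⟩ := Finite.exists_equiv_fin (Quotient (Equiv.Perm.SameCycle.setoid φ))
  have hq : ∀ x y, q x = q y ↔ φ.SameCycle x y := fun x y => Quotient.eq
  have hflip : ∀ d, (decide (ι (q (θ d)) < ι (q d))) =
      !decide (ι (q d) < ι (q (θ d))) := fun d => by
    have : ι (q (θ d)) ≠ ι (q d) := fun h => hne d ((hq _ _).1 (ι.injective h)).symm
    rcases lt_or_gt_of_ne this with h | h <;> simp [h, h.le]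
  refine ⟨fun d => decide (ι (q d) < ι (q (θ d))), fun d => ?_, fun d => ?_⟩
  · simp only [hθ d, hflip]
  · have h1 : q (θ (π d)) = q d := (hq _ _).2 ⟨-1, by
      rw [zpow_neg_one, Equiv.Perm.inv_eq_iff_eq]
      rfl⟩
    have h2 : q (π d) = q (θ d) := by
      rw [hq]
      have := hmap _ _ ((hq _ _).1 h1)
      rwa [hθ] at this
    simp only [h1, h2, hflip]

lemma exists_involutive_of_even_card {α : Type*} [Finite α] (h : Even (Nat.card α)) :
    ∃ σ : α → α, Function.Involutive σ ∧ ∀ a, σ a ≠ a := by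
  obtain ⟨m, hm⟩ := h
  have : Nat.card α = Nat.card (Fin m × Bool) := by simp [hm, mul_two]
  obtain ⟨ι⟩ : Nonempty (α ≃ Fin m × Bool) := (Finite.card_eq).1 this
  refine ⟨fun a => ι.symm ((ι a).1, !(ι a).2), fun a => by simp, fun a h => ?_⟩
  have := congrArg (fun x => (ι x).2) h
  simp at this

lemma exists_involutive_of_even_fiber {D W : Type*} [Finite D] (p : D → W)
    (h : ∀ w, Even (Nat.card {d // p d = w})) :
    ∃ π : D → D, Function.Involutive π ∧ (∀ d, π d ≠ d) ∧ ∀ d, p (π d) = p d := by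
  choose σ hσ nσ using fun w => exists_involutive_of_even_card (h w)
  have key : ∀ w (x : {d // p d = w}), (σ (p x.1) ⟨x.1, rfl⟩).1 = (σ w x).1 := by
    rintro w ⟨d, rfl⟩
    rfl
  refine ⟨fun d => (σ (p d) ⟨d, rfl⟩).1, fun d => ?_, fun d h => ?_, fun d => (σ _ _).2⟩
  · exact (key _ _).trans (congrArg Subtype.val (hσ _ _))
  · exact nσ _ _ (Subtype.ext h)

/-- A graph that is regular of even degree has a balanced orientation. -/
lemma exists_balanced_orientation [Finite V] {K : SimpleGraph V} {m : ℕ}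
    (hK : IsRegular K (2 * m)) :
    ∃ R : V → V → Prop, (∀ u w, R u w → K.Adj u w ∧ ¬ R w u) ∧
      (∀ v, {w | R v w}.ncard = m) ∧ ∀ v, {w | R w v}.ncard = m := by
  classical
  obtain ⟨hfin⟩ := nonempty_fintype V
  have hcard : ∀ v, DartGraph.degCount (fun d : K.Dart => d.fst) (fun _ => True) v = 2 * m :=
    fun v => by
      rw [degCount_dart, ← hK v]
      congr 1
      ext w
      simp
  obtain ⟨π, hπ, nπ, hfst⟩ := exists_involutive_of_even_fiber (fun d : K.Dart => d.fst) fun v => by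
    have := hcard v
    simp only [DartGraph.degCount, and_true] at this
    rw [Nat.card_eq_fintype_card, Fintype.card_subtype]
    exact ⟨m, by rw [← two_mul, ← this]⟩
  obtain ⟨c, hcθ, hcπ⟩ := exists_colouring_of_involutions (θ := fun d : K.Dart => d.symm)
    Dart.symm_symm hπ Dart.symm_ne nπ
  have hsplit : ∀ v, DartGraph.degCount (fun d : K.Dart => d.fst) (fun d => c d = true) v +
      DartGraph.degCount (fun d : K.Dart => d.fst) (fun d => c d = false) v = 2 * m := fun v => by
    rw [← hcard v, DartGraph.degCount, DartGraph.degCount, DartGraph.degCount,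
      ← Finset.card_union_of_disjoint]
    · congr 1
      ext d
      simp only [Finset.mem_union, Finset.mem_filter, Finset.mem_univ, true_and]
      cases c d <;> simp
    · rw [Finset.disjoint_left]
      intro d h h'
      simp only [Finset.mem_filter] at h h'
      exact absurd (h.2.2.symm.trans h'.2.2) (by decide)
  have heq : ∀ v, DartGraph.degCount (fun d : K.Dart => d.fst) (fun d => c d = true) v =
      DartGraph.degCount (fun d : K.Dart => d.fst) (fun d => c d = false) v := fun v => by
    rw [DartGraph.degCount, DartGraph.degCount]
    refine Finset.card_bij' (fun d _ => π d) (fun d _ => π d) ?_ ?_ (fun d _ => hπ d)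
      (fun d _ => hπ d) <;>
    · intro d hd
      simp only [Finset.mem_filter, Finset.mem_univ, true_and] at hd ⊢
      exact ⟨(hfst d).trans hd.1, by rw [hcπ, hd.2]; rfl⟩
  refine ⟨fun u w => ∃ h : K.Adj u w, c ⟨(u, w), h⟩ = true, fun u w h => ⟨h.1, fun h' => ?_⟩,
    fun v => ?_, fun v => ?_⟩
  · obtain ⟨h1, h2⟩ := h
    obtain ⟨h3, h4⟩ := h'
    have := hcθ ⟨(u, w), h1⟩
    rw [h2] at this
    exact absurd (h4.symm.trans this) (by decide)
  · rw [← degCount_dart (G := K) (fun d => c d = true) v]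
    have := hsplit v
    have := heq v
    omega
  · have h : DartGraph.degCount (fun d : K.Dart => d.fst) (fun d => c d = false) v = m := by
      have := hsplit v
      have := heq v
      omega
    rw [← h, degCount_dart]
    congr 1
    ext w
    constructor
    · rintro ⟨h1, h2⟩
      exact ⟨h1.symm, (hcθ ⟨(w, v), h1⟩).trans (by rw [h2]; rfl)⟩
    · rintro ⟨h1, h2⟩
      exact ⟨h1.symm, (hcθ ⟨(v, w), h1⟩).trans (by rw [h2]; rfl)⟩

lemma exists_injective_of_biregular [Finite V] {R : V → V → Prop} {m : ℕ} (hm : 0 < m)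
    (h1 : ∀ v, {w | R v w}.ncard = m) (h2 : ∀ v, {w | R w v}.ncard = m) :
    ∃ g : V → V, Function.Injective g ∧ ∀ v, R v (g v) := by
  classical
  obtain ⟨hfin⟩ := nonempty_fintype V
  have hout : ∀ v, (Finset.univ.filter fun w => R v w).card = m := fun v => by
    rw [← h1 v, ← Set.ncard_coe_finset]
    simp
  have hin : ∀ v, (Finset.univ.filter fun w => R w v).card = m := fun v => by
    rw [← h2 v, ← Set.ncard_coe_finset]
    simp
  obtain ⟨g, hg, hR⟩ := (Finset.all_card_le_biUnion_card_iff_exists_injective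
    fun v => Finset.univ.filter fun w => R v w).1 fun s => by
      refine le_of_mul_le_mul_right (Finset.card_mul_le_card_mul R (m := m) (n := m) ?_ ?_) hm
      · intro v hv
        rw [← hout v]
        refine Finset.card_le_card fun w hw => ?_
        simp only [Finset.mem_bipartiteAbove, Finset.mem_biUnion]
        exact ⟨⟨v, hv, hw⟩, by simpa using hw⟩
      · intro w _
        rw [← hin w]
        refine Finset.card_le_card fun v hv => ?_
        simp only [Finset.mem_bipartiteBelow] at hv
        simpa using hv.2
  exact ⟨g, hg, fun v => by simpa using hR v⟩

/-- An `l`-factor whose complement in a regular graph has even positive degree extends to an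
`(l + 2)`-factor. -/
lemma exists_factor_add_two [Finite V] {G : SimpleGraph V} {l m : ℕ} (hm : 0 < m)
    (hreg : IsRegular G (l + 2 * m)) {F : G.Subgraph} (hF : IsTFactor F l) :
    ∃ F' : G.Subgraph, IsTFactor F' (l + 2) ∧ F.edgeSet ⊆ F'.edgeSet := by
  classical
  let K : SimpleGraph V :=
    { Adj := fun u w => G.Adj u w ∧ ¬ F.Adj u w
      symm := ⟨fun _ _ h => ⟨h.1.symm, fun h' => h.2 h'.symm⟩⟩
      loopless := ⟨fun _ h => h.1.ne rfl⟩ }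
  have hK : IsRegular K (2 * m) := fun v => by
    have h : K.neighborSet v = G.neighborSet v \ F.neighborSet v := rfl
    rw [h, Set.ncard_sdiff (F.neighborSet_subset v), hreg v]
    have : (F.neighborSet v).ncard = l := hF.2 v
    omega
  obtain ⟨R, hR, h1, h2⟩ := exists_balanced_orientation hK
  obtain ⟨g, hg, hgR⟩ := exists_injective_of_biregular hm h1 h2
  have hgK : ∀ v, K.Adj v (g v) := fun v => (hR _ _ (hgR v)).1
  let F' : G.Subgraph :=
    { verts := Set.univ
      Adj := fun u w => F.Adj u w ∨ g u = w ∨ g w = u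
      adj_sub := by
        rintro u w (h | rfl | rfl)
        exacts [h.adj_sub, (hgK _).1, (hgK _).1.symm]
      edge_vert := fun _ => Set.mem_univ _
      symm := ⟨fun _ _ h => h.imp (fun h => h.symm) fun h => h.symm⟩ }
  refine ⟨F', ⟨fun v => Set.mem_univ v, fun v => ?_⟩, ?_⟩
  · obtain ⟨u, hu⟩ := (Finite.injective_iff_surjective.1 hg) v
    have h : F'.neighborSet v = F.neighborSet v ∪ {g v, u} := by
      ext w
      change F.Adj v w ∨ g v = w ∨ g w = v ↔ F.Adj v w ∨ w = g v ∨ w = u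
      rw [← hu, hg.eq_iff, eq_comm (a := g (g u))]
    have hne : g v ≠ u := by
      rintro rfl
      exact (hR _ _ (hgR v)).2 (by simpa only [hu] using hgR (g v))
    rw [sdeg, h, Set.ncard_union_eq, Set.ncard_pair hne]
    · exact congrArg (· + 2) (hF.2 v)
    · rw [Set.disjoint_right]
      rintro w (rfl | rfl) hw
      · exact (hgK v).2 hw
      · exact (hgK w).2 (hu ▸ hw.symm)
  · rintro ⟨u, w⟩ h
    exact Or.inl h

lemma exists_factor_ge [Finite V] {G : SimpleGraph V} {r l : ℕ} (hreg : IsRegular G r)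
    {F : G.Subgraph} (hF : IsTFactor F l) (k : ℕ) (hk : l + 2 * k ≤ r) (hr : Even (r - l)) :
    ∃ F' : G.Subgraph, IsTFactor F' (l + 2 * k) ∧ F.edgeSet ⊆ F'.edgeSet := by
  induction k with
  | zero => exact ⟨F, hF, subset_rfl⟩
  | succ k ih =>
    obtain ⟨F₁, h1, hs⟩ := ih (by omega)
    obtain ⟨m, hm⟩ := hr
    obtain ⟨F₂, h2, hs'⟩ := exists_factor_add_two (m := m - k) (by omega)
      (by rwa [show l + 2 * k + 2 * (m - k) = r by omega]) h1
    exact ⟨F₂, h2, hs.trans hs'⟩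

end Petersen

/-- In a 2-connected 3t-regular graph, for any set of pairwise edge-disjoint odd cycles,
any edge `e`, and any `l` with `t ≤ l ≤ 3t` and `l ≡ t (mod 2)`, there is an `l`-factor
containing `e` and meeting every cycle of the set. -/
theorem stmt_5 {V : Type*} [Fintype V] (t : ℕ) (ht : 1 ≤ t) (G : SimpleGraph V)
    (hconn : TwoConnected G) (hreg : IsRegular G (3 * t))
    (𝒪 : Set G.Subgraph) (hodd : ∀ O ∈ 𝒪, IsOddCycleSG O)
    (hdisj : PairwiseEdgeDisjoint 𝒪)
    (e : Sym2 V) (he : e ∈ G.edgeSet) :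
    ∀ l : ℕ, t ≤ l → l ≤ 3 * t → l % 2 = t % 2 →
      ∃ F : G.Subgraph, IsTFactor F l ∧ e ∈ F.edgeSet ∧
        ∀ O ∈ 𝒪, (F.edgeSet ∩ O.edgeSet).Nonempty := by
  intro l htl hl hpar
  obtain ⟨F, hF, heF, hO⟩ := exists_factor_meeting_odd_cycles hconn hreg hodd hdisj e he
  obtain ⟨F', hF', hs⟩ := exists_factor_ge hreg hF ((l - t) / 2) (by omega) ⟨t, by omega⟩
  rw [show t + 2 * ((l - t) / 2) = l by omega] at hF'
  exact ⟨F', hF', hs heF, fun O h => (hO O h).mono (Set.inter_subset_inter_left _ hs)⟩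

end PaperFormalization
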